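/- arXiv:1507.06099 — 7 statements merged into one kernel-verified Lean document; each statement's English description precedes it below -/
import Mathlib

section
/- Let m ≥ 2 be an integer and let p be a real number with p ≥ 2m, and set λ = 2mp/(mp + p − 2m). Then for every positive integer n and every m-linear form T : ℓ_p^n × ⋯ × ℓ_p^n → 𝕂 (𝕂 = ℝ or ℂ), one has (∑_{j_1,…,j_m=1}^n |T(e_{j_1},…,e_{j_m})|^λ)^{1/λ} ≤ (√2)^{m−1} ‖T‖. -/
open scoped BigOperators

/-- The `ℓ_p` norm of a vector in `𝕂^n`: `(∑ i, ‖x i‖^p)^(1/p)`. -/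
noncomputable def lpNorm (𝕂 : Type*) [RCLike 𝕂] (p : ℝ) {n : ℕ} (x : Fin n → 𝕂) : ℝ :=
  (∑ i, ‖x i‖ ^ p) ^ (1 / p)

/-- The sup norm of an `m`-linear form on `ℓ_p^n × ⋯ × ℓ_p^n`. -/
noncomputable def multilinearNorm (𝕂 : Type*) [RCLike 𝕂] (p : ℝ) {m n : ℕ}
    (T : MultilinearMap 𝕂 (fun _ : Fin m => Fin n → 𝕂) 𝕂) : ℝ :=
  sSup {t : ℝ | ∃ x : Fin m → Fin n → 𝕂, (∀ k, lpNorm 𝕂 p (x k) ≤ 1) ∧ t = ‖T x‖}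



section Rademacher

/-- The real sign attached to a Boolean. -/
def boolSign (b : Bool) : ℝ := if b then 1 else -1

@[simp] lemma boolSign_true : boolSign true = 1 := rfl

@[simp] lemma boolSign_false : boolSign false = -1 := rfl

@[simp] lemma boolSign_not (b : Bool) : boolSign (!b) = -boolSign b := by
  cases b <;> simp

@[simp] lemma abs_boolSign (b : Bool) : |boolSign b| = 1 := by
  cases b <;> simp

/-- Flip the `i`-th coordinate of a point of the discrete cube. -/
def flipCoord {n : ℕ} (i : Fin n) (ε : Fin n → Bool) : Fin n → Bool :=
  Function.update ε i (!ε i)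

lemma flipCoord_involutive {n : ℕ} (i : Fin n) : Function.Involutive (flipCoord i) := by
  intro ε
  simp [flipCoord]

lemma flipCoord_zero_cons {n : ℕ} (b : Bool) (ε : Fin n → Bool) :
    flipCoord 0 (Fin.cons b ε : Fin (n + 1) → Bool) = Fin.cons (!b) ε := by
  simp [flipCoord]

lemma flipCoord_succ_cons {n : ℕ} (b : Bool) (ε : Fin n → Bool) (i : Fin n) :
    flipCoord i.succ (Fin.cons b ε : Fin (n + 1) → Bool) = Fin.cons b (flipCoord i ε) := by
  simp [flipCoord, Fin.cons_update]

lemma expect_fin_cons {α : Type*} [Fintype α] {n : ℕ} (F : (Fin (n + 1) → α) → ℝ) :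
    𝔼 x, F x = 𝔼 a, 𝔼 y : Fin n → α, F (Fin.cons a y) := by
  rw [← Finset.expect_product', Finset.univ_product_univ]
  exact (Fintype.expect_equiv (Fin.consEquiv fun _ => α) _ _ fun _ => rfl).symm

lemma expect_cube_succ {n : ℕ} (F : (Fin (n + 1) → Bool) → ℝ) :
    𝔼 ε, F ε = 𝔼 ε : Fin n → Bool, (F (Fin.cons true ε) + F (Fin.cons false ε)) / 2 := by
  rw [expect_fin_cons, Fintype.expect_eq_sum_div_card, Fintype.sum_bool,
    ← Finset.expect_add_distrib, Finset.expect_div]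
  simp

/-- The Dirichlet form of the simple random walk on the discrete cube. -/
noncomputable def cubeEnergy {n : ℕ} (f : (Fin n → Bool) → ℝ) : ℝ :=
  ∑ i, 𝔼 ε, (f ε - f (flipCoord i ε)) ^ 2 / 4

lemma cubeEnergy_succ {n : ℕ} (f : (Fin (n + 1) → Bool) → ℝ) :
    cubeEnergy f =
      cubeEnergy (fun ε => (f (Fin.cons true ε) + f (Fin.cons false ε)) / 2) +
      cubeEnergy (fun ε => (f (Fin.cons true ε) - f (Fin.cons false ε)) / 2) +
      𝔼 ε : Fin n → Bool, ((f (Fin.cons true ε) - f (Fin.cons false ε)) / 2) ^ 2 := by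
  unfold cubeEnergy
  rw [Fin.sum_univ_succ, ← Finset.sum_add_distrib, add_comm]
  congr 1
  · refine Finset.sum_congr rfl fun i _ => ?_
    rw [expect_cube_succ, ← Finset.expect_add_distrib]
    refine Finset.expect_congr rfl fun ε _ => ?_
    simp only [flipCoord_succ_cons]
    ring
  · rw [expect_cube_succ]
    refine Finset.expect_congr rfl fun ε _ => ?_
    simp only [flipCoord_zero_cons, Bool.not_true, Bool.not_false]
    ring

lemma expect_sq_cube_succ {n : ℕ} (f : (Fin (n + 1) → Bool) → ℝ) :
    𝔼 ε, f ε ^ 2 =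
      𝔼 ε : Fin n → Bool, ((f (Fin.cons true ε) + f (Fin.cons false ε)) / 2) ^ 2 +
      𝔼 ε : Fin n → Bool, ((f (Fin.cons true ε) - f (Fin.cons false ε)) / 2) ^ 2 := by
  rw [expect_cube_succ, ← Finset.expect_add_distrib]
  refine Finset.expect_congr rfl fun ε _ => ?_
  ring

/-- The Poincaré inequality on the discrete cube. -/
lemma cube_poincare {n : ℕ} (f : (Fin n → Bool) → ℝ) :
    𝔼 ε, f ε ^ 2 - (𝔼 ε, f ε) ^ 2 ≤ cubeEnergy f := by
  induction n with
  | zero => simp [cubeEnergy]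
  | succ n ih =>
    have ha := ih fun ε => (f (Fin.cons true ε) + f (Fin.cons false ε)) / 2
    have hb : 0 ≤ cubeEnergy fun ε => (f (Fin.cons true ε) - f (Fin.cons false ε)) / 2 :=
      Finset.sum_nonneg fun i _ => Finset.expect_nonneg fun ε _ => by positivity
    rw [expect_sq_cube_succ, cubeEnergy_succ, expect_cube_succ]
    linarith

/-- Beyond the first Walsh level, the spectral gap of the discrete cube is `2`. -/
lemma cube_second_gap {n : ℕ} (f : (Fin n → Bool) → ℝ) :
    2 * 𝔼 ε, f ε ^ 2 - 2 * (𝔼 ε, f ε) ^ 2 - ∑ i, (𝔼 ε, f ε * boolSign (ε i)) ^ 2 ≤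
      cubeEnergy f := by
  induction n with
  | zero => simp [cubeEnergy]
  | succ n ih =>
    have ha := ih fun ε => (f (Fin.cons true ε) + f (Fin.cons false ε)) / 2
    have hb := cube_poincare fun ε : Fin n → Bool =>
      (f (Fin.cons true ε) - f (Fin.cons false ε)) / 2
    rw [expect_sq_cube_succ, cubeEnergy_succ, expect_cube_succ, Fin.sum_univ_succ]
    have h0 : 𝔼 ε, f ε * boolSign (ε 0) =
        𝔼 ε : Fin n → Bool, (f (Fin.cons true ε) - f (Fin.cons false ε)) / 2 := by
      rw [expect_cube_succ]
      refine Finset.expect_congr rfl fun ε _ => ?_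
      simp
      ring
    have hs (i : Fin n) : 𝔼 ε, f ε * boolSign (ε i.succ) =
        𝔼 ε : Fin n → Bool,
          (f (Fin.cons true ε) + f (Fin.cons false ε)) / 2 * boolSign (ε i) := by
      rw [expect_cube_succ]
      refine Finset.expect_congr rfl fun ε _ => ?_
      simp
      ring
    simp only [h0, hs]
    linarith

variable {E : Type*} [NormedAddCommGroup E] [NormedSpace ℝ E]

lemma sum_flipCoord_smul {n : ℕ} (v : Fin n → E) (ε : Fin n → Bool) :
    ∑ i, ∑ j, boolSign (flipCoord i ε j) • v j =
      ((n : ℝ) - 2) • ∑ j, boolSign (ε j) • v j := by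
  rw [Finset.sum_comm, Finset.smul_sum]
  refine Finset.sum_congr rfl fun j _ => ?_
  have h (i : Fin n) : boolSign (flipCoord i ε j) • v j =
      boolSign (ε j) • v j - if i = j then (2 * boolSign (ε j)) • v j else 0 := by
    by_cases hij : i = j
    · subst hij
      simp [flipCoord]
      module
    · simp [flipCoord, hij, Function.update_of_ne (Ne.symm hij)]
  simp only [h, Finset.sum_sub_distrib, Finset.sum_ite_eq', Finset.mem_univ, if_true,
    Finset.sum_const, Finset.card_univ, Fintype.card_fin]
  module

/-- The Khinchine–Kahane inequality between first and second moments, with the optimal constant. -/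
lemma expect_norm_sq_le_two_mul_sq {n : ℕ} (v : Fin n → E) :
    𝔼 ε : Fin n → Bool, ‖∑ i, boolSign (ε i) • v i‖ ^ 2 ≤
      2 * (𝔼 ε : Fin n → Bool, ‖∑ i, boolSign (ε i) • v i‖) ^ 2 := by
  set f : (Fin n → Bool) → ℝ := fun ε => ‖∑ i, boolSign (ε i) • v i‖ with hf
  have heven (ε : Fin n → Bool) : f (fun i => !ε i) = f ε := by
    simp [hf]
  have hlevel (i : Fin n) : 𝔼 ε, f ε * boolSign (ε i) = 0 := by
    have h : 𝔼 ε, f ε * boolSign (ε i) = 𝔼 ε, -(f ε * boolSign (ε i)) := by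
      refine Fintype.expect_equiv (Equiv.piCongrRight fun _ => Equiv.boolNot) _ _ fun ε => ?_
      change _ = -(f (fun i => !ε i) * boolSign (!ε i))
      rw [heven]
      simp
    rw [Finset.expect_neg_distrib] at h
    linarith
  have hflip (i : Fin n) : 𝔼 ε, f (flipCoord i ε) ^ 2 = 𝔼 ε, f ε ^ 2 :=
    Fintype.expect_equiv (flipCoord_involutive i).toPerm _ _ fun _ => rfl
  have hsum (ε : Fin n → Bool) : ((n : ℝ) - 2) * f ε ≤ ∑ i, f (flipCoord i ε) := by
    calc ((n : ℝ) - 2) * f ε ≤ ‖((n : ℝ) - 2) • ∑ j, boolSign (ε j) • v j‖ := by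
          rw [norm_smul]
          exact mul_le_mul_of_nonneg_right (le_abs_self _) (norm_nonneg _)
      _ ≤ _ := by
          rw [← sum_flipCoord_smul]
          exact norm_sum_le _ _
  have henergy : cubeEnergy f ≤ 𝔼 ε, f ε ^ 2 := by
    have h (i : Fin n) : 𝔼 ε, (f ε - f (flipCoord i ε)) ^ 2 / 4 =
        (𝔼 ε, f ε ^ 2) / 2 - (𝔼 ε, f ε * f (flipCoord i ε)) / 2 := by
      calc 𝔼 ε, (f ε - f (flipCoord i ε)) ^ 2 / 4
          = 𝔼 ε, (f ε ^ 2 / 4 + f (flipCoord i ε) ^ 2 / 4 - f ε * f (flipCoord i ε) / 2) :=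
            Finset.expect_congr rfl fun ε _ => by ring
        _ = _ := by
          rw [Finset.expect_sub_distrib, Finset.expect_add_distrib, ← Finset.expect_div,
            ← Finset.expect_div, ← Finset.expect_div, hflip]
          ring
    have hcross : ((n : ℝ) - 2) * 𝔼 ε, f ε ^ 2 ≤ ∑ i, 𝔼 ε, f ε * f (flipCoord i ε) := by
      rw [← Finset.expect_sum_comm, Finset.mul_expect]
      refine Finset.expect_le_expect fun ε _ => ?_
      rw [← Finset.mul_sum]
      nlinarith [mul_le_mul_of_nonneg_left (hsum ε) (norm_nonneg _ : 0 ≤ f ε)]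
    unfold cubeEnergy
    simp only [h, Finset.sum_sub_distrib, ← Finset.sum_div, Finset.sum_const, Finset.card_univ,
      Fintype.card_fin, nsmul_eq_mul]
    linarith
  have := cube_second_gap f
  simp only [hlevel, ne_eq, OfNat.ofNat_ne_zero, not_false_eq_true, zero_pow,
    Finset.sum_const_zero] at this
  linarith

end Rademacher

/-- Orthogonality of the Rademacher signs. -/
lemma expect_norm_add_sum_sq {H : Type*} [NormedAddCommGroup H] [InnerProductSpace ℝ H]
    {n : ℕ} (w : H) (v : Fin n → H) :
    𝔼 ε : Fin n → Bool, ‖w + ∑ i, boolSign (ε i) • v i‖ ^ 2 = ‖w‖ ^ 2 + ∑ i, ‖v i‖ ^ 2 := by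
  induction n generalizing w with
  | zero => simp
  | succ n ih =>
    have h1 := ih (w + v 0) fun i => v i.succ
    have h2 := ih (w - v 0) fun i => v i.succ
    rw [expect_cube_succ, Fin.sum_univ_succ]
    simp only [Fin.sum_univ_succ, Fin.cons_zero, Fin.cons_succ, boolSign_true, boolSign_false,
      one_smul, neg_smul, ← add_assoc, ← sub_eq_add_neg]
    rw [← Finset.expect_div, Finset.expect_add_distrib, h1, h2]
    have := parallelogram_law_with_norm ℝ w (v 0)
    nlinarith

/-- The Khinchine inequality for Hilbert space valued Rademacher sums. -/
lemma sqrt_sum_norm_sq_le_expect {H : Type*} [NormedAddCommGroup H] [InnerProductSpace ℝ H]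
    {n : ℕ} (v : Fin n → H) :
    √(∑ i, ‖v i‖ ^ 2) ≤ √2 * 𝔼 ε : Fin n → Bool, ‖∑ i, boolSign (ε i) • v i‖ := by
  have h := expect_norm_add_sum_sq 0 v
  simp only [zero_add, norm_zero, ne_eq, OfNat.ofNat_ne_zero, not_false_eq_true, zero_pow] at h
  have h0 : 0 ≤ 𝔼 ε : Fin n → Bool, ‖∑ i, boolSign (ε i) • v i‖ :=
    Finset.expect_nonneg fun _ _ => norm_nonneg _
  rw [← h]
  refine Real.sqrt_le_iff.2 ⟨by positivity, ?_⟩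
  rw [mul_pow, Real.sq_sqrt zero_le_two]
  exact expect_norm_sq_le_two_mul_sq v

section MixedNorm

variable {𝕂 : Type*} [RCLike 𝕂]

/-- The multiple Khinchine inequality for a finite family of multilinear forms. -/
lemma sqrt_sum_sum_norm_sq_le_expect {M n : ℕ} {ι : Type} [Fintype ι]
    (g : ι → MultilinearMap 𝕂 (fun _ : Fin M => Fin n → 𝕂) 𝕂) :
    √(∑ a, ∑ J : Fin M → Fin n, ‖g a fun i => Pi.single (J i) 1‖ ^ 2) ≤
      √2 ^ M * 𝔼 ε : Fin M → Fin n → Bool, √(∑ a, ‖g a fun i j => (boolSign (ε i j) : 𝕂)‖ ^ 2) := by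
  induction M generalizing ι with
  | zero =>
    simp only [Finset.univ_unique, Finset.sum_singleton, Finset.expect_singleton, pow_zero, one_mul]
    refine le_of_eq (congrArg Real.sqrt (Finset.sum_congr rfl fun a _ => ?_))
    congr 3
    exact Subsingleton.elim _ _
  | succ M ih =>
    have hih := ih fun a : ι × Fin n => (g a.1).curryLeft (Pi.single a.2 1)
    have hleft : ∑ a, ∑ J : Fin (M + 1) → Fin n, ‖g a fun i => Pi.single (J i) 1‖ ^ 2 =
        ∑ a : ι × Fin n, ∑ J : Fin M → Fin n,
          ‖(g a.1).curryLeft (Pi.single a.2 1) fun i => Pi.single (J i) 1‖ ^ 2 := by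
      rw [Fintype.sum_prod_type]
      refine Finset.sum_congr rfl fun a _ => ?_
      rw [← Fintype.sum_prod_type', ← (Fin.consEquiv fun _ => Fin n).sum_comp]
      refine Finset.sum_congr rfl fun J _ => ?_
      simp only [MultilinearMap.curryLeft_apply]
      congr 3
      ext i
      refine Fin.cases ?_ (fun i => ?_) i <;> simp [Fin.consEquiv]
    have hstep (ε : Fin M → Fin n → Bool) :
        √(∑ a : ι × Fin n,
          ‖(g a.1).curryLeft (Pi.single a.2 1) fun i j => (boolSign (ε i j) : 𝕂)‖ ^ 2) ≤
        √2 * 𝔼 δ : Fin n → Bool, √(∑ a, ‖g a fun i j =>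
          (boolSign ((Fin.cons δ ε : Fin (M + 1) → Fin n → Bool) i j) : 𝕂)‖ ^ 2) := by
      have h := sqrt_sum_norm_sq_le_expect fun j : Fin n => (WithLp.toLp 2 fun a =>
        (g a).curryLeft (Pi.single j 1) fun i j => (boolSign (ε i j) : 𝕂) : EuclideanSpace 𝕂 ι)
      simp only [EuclideanSpace.norm_sq_eq] at h
      rw [Finset.sum_comm, ← Fintype.sum_prod_type'] at h
      refine h.trans_eq ?_
      congr 1
      refine Finset.expect_congr rfl fun δ _ => ?_
      rw [EuclideanSpace.norm_eq]
      congr 1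
      refine Finset.sum_congr rfl fun a _ => ?_
      congr 2
      have hδ : (fun i j => (boolSign ((Fin.cons δ ε : Fin (M + 1) → Fin n → Bool) i j) : 𝕂)) =
          Fin.cons (fun j => (boolSign (δ j) : 𝕂)) fun i j => (boolSign (ε i j) : 𝕂) := by
        ext i
        refine Fin.cases ?_ (fun i => ?_) i <;> simp
      rw [hδ, ← MultilinearMap.curryLeft_apply, pi_eq_sum_univ' fun j => (boolSign (δ j) : 𝕂)]
      simp only [map_sum, map_smul, sum_apply, smul_apply]
      simp [RCLike.real_smul_eq_coe_mul]
    rw [hleft]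
    refine hih.trans ?_
    rw [pow_succ √2 M, mul_assoc, expect_fin_cons, Finset.expect_comm]
    refine mul_le_mul_of_nonneg_left ?_ (pow_nonneg (Real.sqrt_nonneg 2) M)
    rw [Finset.mul_expect]
    exact Finset.expect_le_expect fun ε _ => hstep ε

lemma sum_norm_single_le {n : ℕ} (L : (Fin n → 𝕂) →ₗ[𝕂] 𝕂) {C : ℝ}
    (hL : ∀ z, (∀ j, ‖z j‖ ≤ 1) → ‖L z‖ ≤ C) : ∑ j, ‖L (Pi.single j 1)‖ ≤ C := by
  have h (j : Fin n) : ∃ c : 𝕂, ‖c‖ = 1 ∧ (‖L (Pi.single j 1)‖ : 𝕂) = c * L (Pi.single j 1) :=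
    RCLike.exists_norm_eq_mul_self _
  choose c hc hcL using h
  have hsum : L c = ((∑ j, ‖L (Pi.single j 1)‖ : ℝ) : 𝕂) := by
    conv_lhs => rw [pi_eq_sum_univ' c]
    simp [hcL]
  have := hL c fun j => (hc j).le
  rw [hsum, RCLike.norm_ofReal] at this
  exact (le_abs_self _).trans this

/-- The mixed `(ℓ_1, ℓ_2)` Littlewood inequality. -/
lemma sum_sqrt_sum_norm_sq_le {M n : ℕ}
    (T : MultilinearMap 𝕂 (fun _ : Fin (M + 1) => Fin n → 𝕂) 𝕂) {C : ℝ}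
    (hT : ∀ y, (∀ i j, ‖y i j‖ ≤ 1) → ‖T y‖ ≤ C) (k : Fin (M + 1)) :
    ∑ j, √(∑ J : Fin (M + 1) → Fin n with J k = j, ‖T fun i => Pi.single (J i) 1‖ ^ 2) ≤ √2 ^ M * C := by
  have hfiber (j : Fin n) : ∑ J : Fin (M + 1) → Fin n with J k = j, ‖T fun i => Pi.single (J i) 1‖ ^ 2 =
      ∑ J : Fin M → Fin n, ‖T.curryMid k (Pi.single j 1) fun i => Pi.single (J i) 1‖ ^ 2 := by
    refine Finset.sum_bij' (fun J _ => k.removeNth J) (fun J _ => k.insertNth j J)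
      (by simp) (by simp) ?_ (by simp) ?_
    · intro J hJ
      obtain rfl : J k = j := by simpa using hJ
      simp
    · intro J hJ
      obtain rfl : J k = j := by simpa using hJ
      rw [MultilinearMap.curryMid_apply_apply]
      congr 3
      ext i
      refine Fin.succAboveCases k ?_ (fun i => ?_) i <;> simp [Fin.removeNth]
  have hterm (j : Fin n) : √(∑ J : Fin (M + 1) → Fin n with J k = j, ‖T fun i => Pi.single (J i) 1‖ ^ 2) ≤
      √2 ^ M * 𝔼 ε : Fin M → Fin n → Bool,
        ‖T.curryMid k (Pi.single j 1) fun i j => (boolSign (ε i j) : 𝕂)‖ := by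
    have h := sqrt_sum_sum_norm_sq_le_expect fun _ : Unit => T.curryMid k (Pi.single j 1)
    simp only [Finset.univ_unique, Finset.sum_singleton, norm_nonneg, Real.sqrt_sq] at h
    rw [hfiber]
    exact h
  refine (Finset.sum_le_sum fun j _ => hterm j).trans ?_
  rw [← Finset.mul_sum, ← Finset.expect_sum_comm]
  gcongr
  refine Finset.expect_le Finset.univ_nonempty fun ε _ => ?_
  let L : (Fin n → 𝕂) →ₗ[𝕂] 𝕂 :=
    { toFun := fun z => T.curryMid k z fun i j => (boolSign (ε i j) : 𝕂)
      map_add' := by simp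
      map_smul' := by simp }
  refine sum_norm_single_le L fun z hz => hT _ fun i => ?_
  refine Fin.succAboveCases k ?_ (fun i => ?_) i <;> simp [hz]

end MixedNorm

section Interpolation

variable {m n : ℕ}

/-- The pointwise interpolation inequality obtained from the weighted arithmetic-geometric mean
inequality. -/
lemma rpow_le_weighted_sum (hm : 0 < m) {p lam δ : ℝ} (hlam : 0 < lam) (hδ : 0 ≤ δ)
    (hp : 1 / p = 1 / (2 * m) - δ) (hrel : 1 + lam / 2 = lam * (1 + δ))
    {a : ℝ} (ha : 0 < a) {D : Fin m → ℝ} (hD : ∀ i, 0 < D i) :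
    a ^ lam ≤ (1 + δ)⁻¹ * ((∑ k, (√(D k))⁻¹ * (a ^ (1 + lam / 2) * ∏ i, D i ^ (1 / p))) / m) +
      (1 - (1 + δ)⁻¹) * ∏ i, D i := by
  have hm' : (0 : ℝ) < m := by exact_mod_cast hm
  have hδ1 : 0 < 1 + δ := by linarith
  set d := ∏ i, D i with hd
  have hd0 : 0 < d := Finset.prod_pos fun i _ => hD i
  have hgm : d ^ (-(1 / (2 * m)) : ℝ) ≤ (∑ k, (√(D k))⁻¹) / m := by
    have h := Real.geom_mean_le_arith_mean_weighted Finset.univ (fun _ : Fin m => 1 / (m : ℝ))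
      (fun k => (√(D k))⁻¹) (fun _ _ => by positivity) (by simp [hm.ne'])
      (fun k _ => by positivity)
    rw [← Finset.mul_sum] at h
    have hprod : ∏ k, (√(D k))⁻¹ ^ (1 / (m : ℝ)) = d ^ (-(1 / (2 * m)) : ℝ) := by
      rw [hd, ← Real.finsetProd_rpow _ _ fun i _ => (hD i).le]
      refine Finset.prod_congr rfl fun i _ => ?_
      rw [Real.sqrt_eq_rpow, ← Real.rpow_neg (hD i).le, ← Real.rpow_mul (hD i).le]
      congr 1
      field_simp
    rw [hprod] at h
    linarith [one_div_mul_eq_div (m : ℝ) (∑ k, (√(D k))⁻¹)]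
  have hX : ∏ i, D i ^ (1 / p) = d ^ (1 / p) :=
    Real.finsetProd_rpow _ _ (fun i _ => (hD i).le) _
  set q := a ^ (1 + lam / 2) * d ^ (-δ) with hq
  have hq_le : q ≤ (∑ k, (√(D k))⁻¹ * (a ^ (1 + lam / 2) * ∏ i, D i ^ (1 / p))) / m := by
    rw [← Finset.sum_mul, hX, mul_div_right_comm]
    have hexp : -δ = -(1 / (2 * m)) + 1 / p := by
      rw [hp]
      ring
    calc q = d ^ (-(1 / (2 * m)) : ℝ) * (a ^ (1 + lam / 2) * d ^ (1 / p)) := by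
          rw [mul_left_comm, ← Real.rpow_add hd0, ← hexp]
      _ ≤ _ := by gcongr
  have hinv : (1 + δ)⁻¹ ≤ 1 := inv_le_one_of_one_le₀ (by linarith)
  have heq : a ^ lam = q ^ (1 + δ)⁻¹ * d ^ (1 - (1 + δ)⁻¹) := by
    rw [hq, Real.mul_rpow (by positivity) (by positivity), ← Real.rpow_mul ha.le,
      ← Real.rpow_mul hd0.le, mul_assoc, ← Real.rpow_add hd0, hrel]
    have h1 : lam * (1 + δ) * (1 + δ)⁻¹ = lam := by field_simp
    have h2 : -δ * (1 + δ)⁻¹ + (1 - (1 + δ)⁻¹) = 0 := by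
      field_simp
      ring
    rw [h1, h2, Real.rpow_zero, mul_one]
  calc a ^ lam ≤ (1 + δ)⁻¹ * q + (1 - (1 + δ)⁻¹) * d := by
        rw [heq]
        exact Real.geom_mean_le_arith_mean2_weighted (by positivity) (by linarith)
          (by positivity) hd0.le (by ring)
    _ ≤ _ := by gcongr

/-- Weighted mixed `(ℓ_1, ℓ_2)` estimates in every direction give a lower bound when the array is
normalized in `ℓ_lam`. -/
lemma one_le_of_sum_rpow_eq_one (hm : 0 < m) {p lam δ C : ℝ} (hp0 : 0 < p) (hlam : 0 < lam)
    (hδ : 0 ≤ δ) (hp : 1 / p = 1 / (2 * m) - δ) (hrel : 1 + lam / 2 = lam * (1 + δ))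
    {a : (Fin m → Fin n) → ℝ} (ha : ∀ J, 0 ≤ a J) (hsum : ∑ J, a J ^ lam = 1)
    (h : ∀ x : Fin m → Fin n → ℝ, (∀ i j, 0 ≤ x i j) → (∀ i, ∑ j, x i j ^ p ≤ 1) →
      ∀ k, ∑ j, √(∑ J : Fin m → Fin n with J k = j, (a J * ∏ i, x i (J i)) ^ 2) ≤ C) :
    1 ≤ C := by
  have hm' : (0 : ℝ) < m := by exact_mod_cast hm
  set D : Fin m → Fin n → ℝ := fun i j => ∑ J : Fin m → Fin n with J i = j, a J ^ lam with hDdef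
  have hD0 (i j) : 0 ≤ D i j := Finset.sum_nonneg fun J _ => Real.rpow_nonneg (ha J) _
  have hDsum (i) : ∑ j, D i j = 1 := by
    rw [← hsum]
    exact Finset.sum_fiberwise _ _ _
  have hDpos (i) {J} (hJ : 0 < a J) : 0 < D i (J i) :=
    (Real.rpow_pos_of_pos hJ lam).trans_le <|
      Finset.single_le_sum (f := fun J => a J ^ lam) (fun J _ => Real.rpow_nonneg (ha J) _)
        (by simp)
  have hC (k) : ∑ J : Fin m → Fin n,
      (√(D k (J k)))⁻¹ * (a J ^ (1 + lam / 2) * ∏ i, D i (J i) ^ (1 / p)) ≤ C := by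
    refine le_trans ?_ (h (fun i j => D i j ^ (1 / p)) (fun i j => Real.rpow_nonneg (hD0 i j) _)
      (fun i => ?_) k)
    · rw [← Finset.sum_fiberwise Finset.univ fun J : Fin m → Fin n => J k]
      refine Finset.sum_le_sum fun j _ => ?_
      have hcs := Real.sum_mul_le_sqrt_mul_sqrt
        (Finset.univ.filter fun J : Fin m → Fin n => J k = j)
        (fun J => a J * ∏ i, D i (J i) ^ (1 / p)) fun J => a J ^ (lam / 2)
      have hsq : ∑ J : Fin m → Fin n with J k = j, (a J ^ (lam / 2)) ^ 2 = D k j := by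
        refine Finset.sum_congr rfl fun J _ => ?_
        rw [← Real.rpow_natCast, ← Real.rpow_mul (ha J)]
        norm_num
      rw [hsq] at hcs
      calc ∑ J : Fin m → Fin n with J k = j,
            (√(D k (J k)))⁻¹ * (a J ^ (1 + lam / 2) * ∏ i, D i (J i) ^ (1 / p))
          = (√(D k j))⁻¹ * ∑ J : Fin m → Fin n with J k = j,
              (a J * ∏ i, D i (J i) ^ (1 / p)) * a J ^ (lam / 2) := by
            rw [Finset.mul_sum]
            refine Finset.sum_congr rfl fun J hJ => ?_
            rw [(Finset.mem_filter.1 hJ).2, Real.rpow_add' (ha J) (by positivity), Real.rpow_one]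
            ring
        _ ≤ (√(D k j))⁻¹ * (√(∑ J : Fin m → Fin n with J k = j,
              (a J * ∏ i, D i (J i) ^ (1 / p)) ^ 2) * √(D k j)) := by gcongr
        _ ≤ _ := by
            rw [mul_left_comm]
            exact mul_le_of_le_one_right (Real.sqrt_nonneg _) inv_mul_le_one
    · refine le_of_eq (Eq.trans ?_ (hDsum i))
      refine Finset.sum_congr rfl fun j _ => ?_
      rw [← Real.rpow_mul (hD0 i j), one_div_mul_cancel hp0.ne', Real.rpow_one]
  have hprod : ∑ J : Fin m → Fin n, ∏ i, D i (J i) = 1 := by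
    rw [← Fintype.prod_sum]
    simp [hDsum]
  have hinv0 : 0 < (1 + δ)⁻¹ := by positivity
  have hinv : (1 + δ)⁻¹ ≤ 1 := inv_le_one_of_one_le₀ (by linarith)
  have hpt (J) : a J ^ lam ≤
      (1 + δ)⁻¹ * ((∑ k, (√(D k (J k)))⁻¹ *
        (a J ^ (1 + lam / 2) * ∏ i, D i (J i) ^ (1 / p))) / m) +
      (1 - (1 + δ)⁻¹) * ∏ i, D i (J i) := by
    rcases (ha J).eq_or_lt with h0 | hpos
    · rw [← h0, Real.zero_rpow hlam.ne']
      have hX : 0 ≤ ∏ i, D i (J i) := Finset.prod_nonneg fun i _ => hD0 i _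
      have := sub_nonneg.2 hinv
      rw [Real.zero_rpow (by positivity)]
      simp only [zero_mul, mul_zero, Finset.sum_const_zero, zero_div, zero_add]
      positivity
    · exact rpow_le_weighted_sum hm hlam hδ hp hrel hpos fun i => hDpos i hpos
  have htotal := Finset.sum_le_sum fun J (_ : J ∈ Finset.univ) => hpt J
  rw [hsum, Finset.sum_add_distrib, ← Finset.mul_sum, ← Finset.mul_sum, hprod, ← Finset.sum_div,
    Finset.sum_comm] at htotal
  have havg : (∑ k, ∑ J : Fin m → Fin n, (√(D k (J k)))⁻¹ *
      (a J ^ (1 + lam / 2) * ∏ i, D i (J i) ^ (1 / p))) / m ≤ C := by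
    rw [div_le_iff₀ hm', mul_comm]
    simpa using Finset.sum_le_sum fun k (_ : k ∈ Finset.univ) => hC k
  nlinarith [mul_le_mul_of_nonneg_left havg hinv0.le]

/-- Weighted mixed `(ℓ_1, ℓ_2)` estimates in every direction bound the `ℓ_lam` norm. -/
lemma rpow_sum_rpow_le (hm : 0 < m) {p lam δ C : ℝ} (hp0 : 0 < p) (hlam : 0 < lam)
    (hδ : 0 ≤ δ) (hp : 1 / p = 1 / (2 * m) - δ) (hrel : 1 + lam / 2 = lam * (1 + δ)) (hC : 0 ≤ C)
    {a : (Fin m → Fin n) → ℝ} (ha : ∀ J, 0 ≤ a J)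
    (h : ∀ x : Fin m → Fin n → ℝ, (∀ i j, 0 ≤ x i j) → (∀ i, ∑ j, x i j ^ p ≤ 1) →
      ∀ k, ∑ j, √(∑ J : Fin m → Fin n with J k = j, (a J * ∏ i, x i (J i)) ^ 2) ≤ C) :
    (∑ J, a J ^ lam) ^ (1 / lam) ≤ C := by
  have hS0 : 0 ≤ ∑ J, a J ^ lam := Finset.sum_nonneg fun J _ => Real.rpow_nonneg (ha J) _
  rcases hS0.eq_or_lt with hS | hS
  · rwa [← hS, Real.zero_rpow (by positivity)]
  set s := (∑ J, a J ^ lam) ^ (1 / lam) with hs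
  have hs0 : 0 < s := Real.rpow_pos_of_pos hS _
  have hslam : s ^ lam = ∑ J, a J ^ lam := by
    rw [hs, ← Real.rpow_mul hS.le, one_div_mul_cancel hlam.ne', Real.rpow_one]
  have hone : 1 ≤ C / s := by
    refine one_le_of_sum_rpow_eq_one hm hp0 hlam hδ hp hrel (a := fun J => a J / s)
      (fun J => div_nonneg (ha J) hs0.le) ?_ fun x hx hxp k => ?_
    · simp only [Real.div_rpow (ha _) hs0.le]
      rw [← Finset.sum_div, hslam, div_self hS.ne']
    · have hj (j : Fin n) :
          √(∑ J : Fin m → Fin n with J k = j, (a J / s * ∏ i, x i (J i)) ^ 2) =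
          √(∑ J : Fin m → Fin n with J k = j, (a J * ∏ i, x i (J i)) ^ 2) / s := by
        simp only [div_mul_eq_mul_div, div_pow]
        rw [← Finset.sum_div, Real.sqrt_div' _ (sq_nonneg s), Real.sqrt_sq hs0.le]
      simp only [hj]
      rw [← Finset.sum_div]
      exact div_le_div_of_nonneg_right (h x hx hxp k) hs0.le
  rwa [one_le_div hs0] at hone

end Interpolation

section LpNorm

variable {𝕂 : Type*} [RCLike 𝕂] {m n : ℕ} {p : ℝ}

lemma lpNorm_le_one_iff (hp : 0 < p) (x : Fin n → 𝕂) :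
    lpNorm 𝕂 p x ≤ 1 ↔ ∑ j, ‖x j‖ ^ p ≤ 1 := by
  rw [lpNorm, one_div, Real.rpow_inv_le_iff_of_pos (by positivity) zero_le_one hp, Real.one_rpow]

lemma norm_le_one_of_lpNorm_le_one (hp : 0 < p) {x : Fin n → 𝕂} (hx : lpNorm 𝕂 p x ≤ 1)
    (j : Fin n) : ‖x j‖ ≤ 1 := by
  have h : ‖x j‖ ^ p ≤ 1 ^ p := by
    rw [Real.one_rpow]
    exact (Finset.single_le_sum (f := fun j => ‖x j‖ ^ p) (fun j _ => by positivity)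
      (Finset.mem_univ j)).trans ((lpNorm_le_one_iff hp x).1 hx)
  exact (Real.rpow_le_rpow_iff (norm_nonneg _) zero_le_one hp).1 h

lemma multilinearNorm_nonneg (T : MultilinearMap 𝕂 (fun _ : Fin m => Fin n → 𝕂) 𝕂) :
    0 ≤ multilinearNorm 𝕂 p T := by
  refine Real.sSup_nonneg ?_
  rintro t ⟨x, -, rfl⟩
  exact norm_nonneg _

lemma MultilinearMap.apply_eq_sum_single (T : MultilinearMap 𝕂 (fun _ : Fin m => Fin n → 𝕂) 𝕂)
    (x : Fin m → Fin n → 𝕂) :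
    T x = ∑ J : Fin m → Fin n, (∏ i, x i (J i)) * T fun i => Pi.single (J i) 1 := by
  have hx : x = fun i => ∑ j, x i j • (Pi.single j 1 : Fin n → 𝕂) :=
    funext fun i => pi_eq_sum_univ' (x i)
  conv_lhs => rw [hx, T.map_sum]
  simp only [T.map_smul_univ, smul_eq_mul]

lemma norm_le_multilinearNorm (hp : 0 < p)
    (T : MultilinearMap 𝕂 (fun _ : Fin m => Fin n → 𝕂) 𝕂) {x : Fin m → Fin n → 𝕂}
    (hx : ∀ k, lpNorm 𝕂 p (x k) ≤ 1) : ‖T x‖ ≤ multilinearNorm 𝕂 p T := by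
  refine le_csSup ⟨∑ J : Fin m → Fin n, ‖T fun i => Pi.single (J i) 1‖, ?_⟩ ⟨x, hx, rfl⟩
  rintro t ⟨y, hy, rfl⟩
  rw [T.apply_eq_sum_single y]
  refine (norm_sum_le _ _).trans (Finset.sum_le_sum fun J _ => ?_)
  rw [norm_mul, norm_prod]
  exact mul_le_of_le_one_left (norm_nonneg _) <| Finset.prod_le_one (fun _ _ => norm_nonneg _)
    fun i _ => norm_le_one_of_lpNorm_le_one hp (hy i) _

/-- The mixed `(ℓ_1, ℓ_2)` inequality for the diagonal rescalings of an `m`-linear form on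
`ℓ_p^n`. -/
lemma sum_sqrt_sum_weighted_le (hp : 0 < p)
    (T : MultilinearMap 𝕂 (fun _ : Fin (m + 1) => Fin n → 𝕂) 𝕂) {x : Fin (m + 1) → Fin n → ℝ}
    (hx : ∀ i j, 0 ≤ x i j) (hxp : ∀ i, ∑ j, x i j ^ p ≤ 1) (k : Fin (m + 1)) :
    ∑ j, √(∑ J : Fin (m + 1) → Fin n with J k = j,
      (‖T fun i => Pi.single (J i) 1‖ * ∏ i, x i (J i)) ^ 2) ≤
        √2 ^ m * multilinearNorm 𝕂 p T := by
  let T' := T.compLinearMap fun i => LinearMap.mulLeft 𝕂 fun j => (x i j : 𝕂)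
  have hT' (y) (hy : ∀ i j, ‖y i j‖ ≤ 1) : ‖T' y‖ ≤ multilinearNorm 𝕂 p T := by
    refine norm_le_multilinearNorm hp T fun i => (lpNorm_le_one_iff hp _).2 ?_
    refine (Finset.sum_le_sum fun j _ => ?_).trans (hxp i)
    refine Real.rpow_le_rpow (norm_nonneg _) ?_ hp.le
    simp only [LinearMap.mulLeft_apply, Pi.mul_apply, norm_mul, RCLike.norm_ofReal,
      abs_of_nonneg (hx i j)]
    exact mul_le_of_le_one_right (hx i j) (hy i j)
  have hsingle (J : Fin (m + 1) → Fin n) : ‖T' fun i => Pi.single (J i) 1‖ =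
      ‖T fun i => Pi.single (J i) 1‖ * ∏ i, x i (J i) := by
    have h (i) : LinearMap.mulLeft 𝕂 (fun j => (x i j : 𝕂)) (Pi.single (J i) 1) =
        (x i (J i) : 𝕂) • (Pi.single (J i) 1 : Fin n → 𝕂) := by
      ext j
      by_cases hj : j = J i
      · subst hj
        simp
      · simp [hj]
    simp only [T', MultilinearMap.compLinearMap_apply, h, T.map_smul_univ, norm_smul, norm_prod,
      RCLike.norm_ofReal, abs_of_nonneg (hx _ _)]
    rw [mul_comm]
  have h := sum_sqrt_sum_norm_sq_le T' hT' k
  simpa only [hsingle] using h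

end LpNorm

theorem hardy_littlewood_praciano_pereira
    (𝕂 : Type*) [RCLike 𝕂] (m : ℕ) (hm : 2 ≤ m) (p lam : ℝ)
    (hp : 2 * m ≤ p) (hlam : lam = 2 * m * p / (m * p + p - 2 * m))
    (n : ℕ) (hn : 0 < n)
    (T : MultilinearMap 𝕂 (fun _ : Fin m => Fin n → 𝕂) 𝕂) :
    (∑ j : Fin m → Fin n, ‖T (fun k => Pi.single (j k) (1 : 𝕂))‖ ^ lam) ^ (1 / lam)
      ≤ Real.sqrt 2 ^ (m - 1) * multilinearNorm 𝕂 p T := by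
  obtain ⟨m, rfl⟩ : ∃ M, m = M + 1 := ⟨m - 1, by omega⟩
  have hm0 : (0 : ℝ) < (m + 1 : ℕ) := by positivity
  generalize hr : ((m + 1 : ℕ) : ℝ) = r at *
  have hp0 : 0 < p := by linarith
  have hden : 0 < r * p + p - 2 * r := by nlinarith
  refine rpow_sum_rpow_le m.succ_pos (δ := 1 / (2 * r) - 1 / p) hp0 ?_ ?_ ?_ ?_
    (mul_nonneg (by positivity) (multilinearNorm_nonneg T)) (fun _ => norm_nonneg _)
    fun x hx hxp k => sum_sqrt_sum_weighted_le hp0 T hx hxp k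
  · rw [hlam]
    positivity
  · exact sub_nonneg.2 (one_div_le_one_div_of_le (by positivity) hp)
  · simp [← hr]
  · have h := (eq_div_iff hden.ne').1 hlam
    field_simp
    linarith
end

section
/- Let m ≥ 2 be an integer and let p be a real number with m < p < 2m. Then for every positive integer n and every m-linear form T : ℓ_p^n × ⋯ × ℓ_p^n → 𝕂 (𝕂 = ℝ or ℂ), one has (∑_{j_1,…,j_m=1}^n |T(e_{j_1},…,e_{j_m})|^{p/(p−m)})^{(p−m)/p} ≤ (√2)^{m−1} ‖T‖. -/
open scoped BigOperators

/-- The average of `f` over the sign vectors in `{1, -1}^n`. -/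
noncomputable def signMean : (n : ℕ) → ((Fin n → ℝ) → ℝ) → ℝ
  | 0, f => f Fin.elim0
  | n + 1, f =>
    (signMean n (fun x => f (Fin.cons 1 x)) + signMean n (fun x => f (Fin.cons (-1) x))) / 2

theorem signMean_mono {n : ℕ} {f g : (Fin n → ℝ) → ℝ}
    (h : ∀ x, (∀ i, x i = 1 ∨ x i = -1) → f x ≤ g x) : signMean n f ≤ signMean n g := by
  induction n with
  | zero => exact h _ (fun i => i.elim0)
  | succ n ih =>
    have h1 := ih (f := fun x => f (Fin.cons 1 x)) (g := fun x => g (Fin.cons 1 x))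
      fun x hx => h _ (Fin.cases (by simp) (by simpa using hx))
    have h2 := ih (f := fun x => f (Fin.cons (-1) x)) (g := fun x => g (Fin.cons (-1) x))
      fun x hx => h _ (Fin.cases (by simp) (by simpa using hx))
    simp only [signMean]
    linarith

theorem signMean_congr {n : ℕ} {f g : (Fin n → ℝ) → ℝ}
    (h : ∀ x, (∀ i, x i = 1 ∨ x i = -1) → f x = g x) : signMean n f = signMean n g :=
  le_antisymm (signMean_mono fun x hx => (h x hx).le) (signMean_mono fun x hx => (h x hx).ge)

theorem signMean_const (n : ℕ) (c : ℝ) : signMean n (fun _ => c) = c := by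
  induction n with
  | zero => rfl
  | succ n ih => simp [signMean, ih]

theorem signMean_add {n : ℕ} (f g : (Fin n → ℝ) → ℝ) :
    signMean n (fun x => f x + g x) = signMean n f + signMean n g := by
  induction n with
  | zero => rfl
  | succ n ih => simp only [signMean, ih]; ring

theorem signMean_const_mul {n : ℕ} (c : ℝ) (f : (Fin n → ℝ) → ℝ) :
    signMean n (fun x => c * f x) = c * signMean n f := by
  induction n with
  | zero => rfl
  | succ n ih => simp only [signMean, ih]; ring

theorem signMean_sub {n : ℕ} (f g : (Fin n → ℝ) → ℝ) :
    signMean n (fun x => f x - g x) = signMean n f - signMean n g := by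
  have h := signMean_add (fun x => f x - g x) g
  simp only [sub_add_cancel] at h
  linarith

theorem signMean_sum {n : ℕ} {ι : Type*} (s : Finset ι) (f : ι → (Fin n → ℝ) → ℝ) :
    signMean n (fun x => ∑ i ∈ s, f i x) = ∑ i ∈ s, signMean n (f i) := by
  induction n with
  | zero => rfl
  | succ n ih =>
    simp only [signMean, ih, ← Finset.sum_add_distrib, Finset.sum_div]

theorem signMean_neg_arg {n : ℕ} (f : (Fin n → ℝ) → ℝ) :
    signMean n (fun x => f (-x)) = signMean n f := by
  induction n with
  | zero => exact congrArg f (Subsingleton.elim _ _)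
  | succ n ih =>
    have hneg (e : ℝ) (x : Fin n → ℝ) :
        -(Fin.cons e x : Fin (n + 1) → ℝ) = Fin.cons (-e) (-x) := by
      ext i; refine Fin.cases ?_ (fun i => ?_) i <;> simp
    simp only [signMean, hneg, neg_neg]
    rw [ih (fun x => f (Fin.cons (-1) x)), ih (fun x => f (Fin.cons 1 x)), add_comm]

theorem sq_signMean_le {n : ℕ} (f : (Fin n → ℝ) → ℝ) :
    signMean n f ^ 2 ≤ signMean n (fun x => f x ^ 2) := by
  have h : signMean n (fun x => 2 * signMean n f * f x - signMean n f ^ 2)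
      ≤ signMean n (fun x => f x ^ 2) :=
    signMean_mono fun x _ => by nlinarith [sq_nonneg (f x - signMean n f)]
  rw [signMean_sub, signMean_const_mul, signMean_const] at h
  linarith

/-- Twice the generator of the heat semigroup on the discrete cube. -/
def cubeLaplacian {n : ℕ} (f : (Fin n → ℝ) → ℝ) (x : Fin n → ℝ) : ℝ :=
  ∑ i, (f x - f (Function.update x i (-x i)))

theorem cubeLaplacian_cons {n : ℕ} (f : (Fin (n + 1) → ℝ) → ℝ) (e : ℝ) (x : Fin n → ℝ) :
    cubeLaplacian f (Fin.cons e x) = f (Fin.cons e x) - f (Fin.cons (-e) x)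
      + cubeLaplacian (fun x => f (Fin.cons e x)) x := by
  simp [cubeLaplacian, Fin.sum_univ_succ, Fin.update_cons_zero, ← Fin.cons_update,
    -Finset.sum_sub_distrib]

theorem cubeLaplacian_add {n : ℕ} (f g : (Fin n → ℝ) → ℝ) (x : Fin n → ℝ) :
    cubeLaplacian (fun x => f x + g x) x = cubeLaplacian f x + cubeLaplacian g x := by
  simp only [cubeLaplacian, ← Finset.sum_add_distrib]
  exact Finset.sum_congr rfl fun i _ => by ring

theorem cubeLaplacian_sub {n : ℕ} (f g : (Fin n → ℝ) → ℝ) (x : Fin n → ℝ) :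
    cubeLaplacian (fun x => f x - g x) x = cubeLaplacian f x - cubeLaplacian g x := by
  simp only [cubeLaplacian, ← Finset.sum_sub_distrib]
  exact Finset.sum_congr rfl fun i _ => by ring

/-- Poincaré inequality on the discrete cube. -/
theorem signMean_poincare {n : ℕ} (f : (Fin n → ℝ) → ℝ) :
    2 * (signMean n (fun x => f x ^ 2) - signMean n f ^ 2)
      ≤ signMean n (fun x => f x * cubeLaplacian f x) := by
  induction n with
  | zero => simp [signMean, cubeLaplacian]
  | succ n ih =>
    have h1 := ih (fun x => f (Fin.cons 1 x))
    have h2 := ih (fun x => f (Fin.cons (-1) x))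
    have h3 := sq_signMean_le (fun x => f (Fin.cons 1 x) - f (Fin.cons (-1) x))
    have h4 : signMean n (fun x => f (Fin.cons 1 x) * cubeLaplacian f (Fin.cons 1 x))
        + signMean n (fun x => f (Fin.cons (-1) x) * cubeLaplacian f (Fin.cons (-1) x))
        = signMean n (fun x => (f (Fin.cons 1 x) - f (Fin.cons (-1) x)) ^ 2)
        + signMean n (fun x => f (Fin.cons 1 x) * cubeLaplacian (fun x => f (Fin.cons 1 x)) x)
        + signMean n
          (fun x => f (Fin.cons (-1) x) * cubeLaplacian (fun x => f (Fin.cons (-1) x)) x) := by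
      simp only [← signMean_add, cubeLaplacian_cons, neg_neg]
      exact signMean_congr fun x _ => by ring
    rw [signMean_sub] at h3
    simp only [signMean]
    rw [h4]
    nlinarith

/-- Poincaré inequality on the discrete cube, sharpened away from the first Walsh level. -/
theorem signMean_poincare_level_two {n : ℕ} (f : (Fin n → ℝ) → ℝ) :
    4 * (signMean n (fun x => f x ^ 2) - signMean n f ^ 2)
      ≤ signMean n (fun x => f x * cubeLaplacian f x)
        + 2 * ∑ i, signMean n (fun x => x i * f x) ^ 2 := by
  induction n with
  | zero => simp [signMean, cubeLaplacian]
  | succ n ih =>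
    obtain ⟨g, hg⟩ : ∃ g : (Fin n → ℝ) → ℝ,
        g = fun x => (f (Fin.cons 1 x) + f (Fin.cons (-1) x)) / 2 := ⟨_, rfl⟩
    obtain ⟨h, hh⟩ : ∃ h : (Fin n → ℝ) → ℝ,
        h = fun x => (f (Fin.cons 1 x) - f (Fin.cons (-1) x)) / 2 := ⟨_, rfl⟩
    have hp : (fun x => f (Fin.cons 1 x)) = fun x => g x + h x := by
      ext x; simp only [hg, hh]; ring
    have hm : (fun x => f (Fin.cons (-1) x)) = fun x => g x - h x := by
      ext x; simp only [hg, hh]; ring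
    have hp' (x) : f (Fin.cons 1 x) = g x + h x := congrFun hp x
    have hm' (x) : f (Fin.cons (-1) x) = g x - h x := congrFun hm x
    have e1 : signMean (n + 1) f = signMean n g := by
      simp only [signMean, hp', hm', signMean_add, signMean_sub]; ring
    have e2 : signMean (n + 1) (fun x => f x ^ 2)
        = signMean n (fun x => g x ^ 2) + signMean n (fun x => h x ^ 2) := by
      simp only [signMean, hp', hm', ← signMean_add]
      rw [div_eq_inv_mul, ← signMean_const_mul]
      exact signMean_congr fun x _ => by ring
    have e3 : signMean (n + 1) (fun x => f x * cubeLaplacian f x)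
        = signMean n (fun x => g x * cubeLaplacian g x)
          + signMean n (fun x => h x * cubeLaplacian h x) + 2 * signMean n (fun x => h x ^ 2) := by
      simp only [signMean, cubeLaplacian_cons, neg_neg, hp', hm', cubeLaplacian_add,
        cubeLaplacian_sub, ← signMean_const_mul, ← signMean_add]
      rw [div_eq_inv_mul, ← signMean_const_mul]
      exact signMean_congr fun x _ => by ring
    have e4 : signMean (n + 1) (fun x => x 0 * f x) = signMean n h := by
      simp only [signMean, hp', hm', Fin.cons_zero, ← signMean_add]
      rw [div_eq_inv_mul, ← signMean_const_mul]
      exact signMean_congr fun x _ => by ring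
    have e5 (i : Fin n) :
        signMean (n + 1) (fun x => x i.succ * f x) = signMean n (fun x => x i * g x) := by
      simp only [signMean, hp', hm', Fin.cons_succ, ← signMean_add]
      rw [div_eq_inv_mul, ← signMean_const_mul]
      exact signMean_congr fun x _ => by ring
    rw [Fin.sum_univ_succ, e1, e2, e3, e4]
    simp only [e5]
    linarith [ih g, signMean_poincare h]

theorem signMean_poincare_even {n : ℕ} (f : (Fin n → ℝ) → ℝ) (hf : ∀ x, f (-x) = f x) :
    4 * (signMean n (fun x => f x ^ 2) - signMean n f ^ 2)
      ≤ signMean n (fun x => f x * cubeLaplacian f x) := by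
  have h0 (i : Fin n) : signMean n (fun x => x i * f x) = 0 := by
    have h1 := signMean_neg_arg (fun x => x i * f x)
    have h2 := signMean_const_mul (-1) (fun x => x i * f x)
    simp only [Pi.neg_apply, hf] at h1
    simp only [neg_mul, one_mul] at h1 h2
    linarith
  simpa [h0] using signMean_poincare_level_two f

theorem cubeLaplacian_norm_sum_le {V : Type*} [NormedAddCommGroup V] [NormedSpace ℝ V]
    {n : ℕ} (v : Fin n → V) (x : Fin n → ℝ) :
    cubeLaplacian (fun x => ‖∑ i, x i • v i‖) x ≤ 2 * ‖∑ i, x i • v i‖ := by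
  have hflip (i : Fin n) : ∑ k, Function.update x i (-x i) k • v k
      = ∑ k, x k • v k - (2 * x i) • v i := by
    rw [eq_sub_iff_add_eq, ← Finset.add_sum_erase _ _ (Finset.mem_univ i),
      ← Finset.add_sum_erase _ (fun k => x k • v k) (Finset.mem_univ i),
      Finset.sum_congr rfl fun k hk => by
        rw [Function.update_of_ne (Finset.ne_of_mem_erase hk)]]
    simp only [Function.update_self]
    module
  have hsum : ∑ i, (∑ k, x k • v k - (2 * x i) • v i)
      = ((n : ℝ) - 2) • ∑ k, x k • v k := by
    rw [Finset.sum_sub_distrib, Finset.sum_const, Finset.card_univ, Fintype.card_fin]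
    simp only [mul_smul, ← Finset.smul_sum]
    module
  have hle := norm_sum_le Finset.univ fun i => ∑ k, x k • v k - (2 * x i) • v i
  rw [hsum, norm_smul] at hle
  have habs := mul_le_mul_of_nonneg_right (le_abs_self ((n : ℝ) - 2))
    (norm_nonneg (∑ k, x k • v k))
  rw [Real.norm_eq_abs] at hle
  simp only [cubeLaplacian, hflip, Finset.sum_sub_distrib, Finset.sum_const, Finset.card_univ,
    Fintype.card_fin, nsmul_eq_mul] at hle ⊢
  linarith

theorem signMean_norm_sq {𝕂 V : Type*} [RCLike 𝕂] [NormedAddCommGroup V] [NormedSpace ℝ V]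
    [InnerProductSpace 𝕂 V] {n : ℕ} (w : V) (v : Fin n → V) :
    signMean n (fun x => ‖w + ∑ i, x i • v i‖ ^ 2) = ‖w‖ ^ 2 + ∑ i, ‖v i‖ ^ 2 := by
  induction n generalizing w with
  | zero => simp [signMean]
  | succ n ih =>
    have h1 := ih (w + v 0) (fun i => v i.succ)
    have h2 := ih (w - v 0) (fun i => v i.succ)
    have h3 := parallelogram_law_with_norm 𝕂 w (v 0)
    simp only [signMean, Fin.sum_univ_succ, Fin.cons_zero, Fin.cons_succ, one_smul, neg_smul,
      ← add_assoc, ← sub_eq_add_neg, h1, h2]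
    nlinarith

/-- The `L²`-`L¹` Khinchine inequality with the optimal constant `√2`. -/
theorem sqrt_sum_norm_sq_le_signMean (𝕂 : Type*) {V : Type*} [RCLike 𝕂] [NormedAddCommGroup V]
    [NormedSpace ℝ V] [InnerProductSpace 𝕂 V] {n : ℕ} (v : Fin n → V) :
    √(∑ i, ‖v i‖ ^ 2) ≤ √2 * signMean n (fun x => ‖∑ i, x i • v i‖) := by
  have h1 := signMean_norm_sq (𝕂 := 𝕂) 0 v
  have h2 := signMean_poincare_even (fun x => ‖∑ i, x i • v i‖) fun x => by
    simp [Finset.sum_neg_distrib]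
  have h3 : signMean n (fun x => ‖∑ i, x i • v i‖
        * cubeLaplacian (fun x => ‖∑ i, x i • v i‖) x)
      ≤ signMean n (fun x => 2 * ‖∑ i, x i • v i‖ ^ 2) := by
    refine signMean_mono fun x _ => ?_
    have := mul_le_mul_of_nonneg_left (cubeLaplacian_norm_sum_le v x)
      (norm_nonneg (∑ i, x i • v i))
    linarith
  have h4 : 0 ≤ signMean n (fun x => ‖∑ i, x i • v i‖) := by
    simpa [signMean_const] using signMean_mono (n := n) (f := fun _ => 0)
      (g := fun x => ‖∑ i, x i • v i‖) fun x _ => norm_nonneg _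
  rw [signMean_const_mul] at h3
  simp only [zero_add, norm_zero, ne_eq, OfNat.ofNat_ne_zero, not_false_eq_true, zero_pow] at h1
  refine Real.sqrt_le_iff.2 ⟨by positivity, ?_⟩
  rw [mul_pow, Real.sq_sqrt (by norm_num), ← h1]
  linarith

theorem Fin.sum_pi_insertNth {A : Type*} [AddCommMonoid A] {k n : ℕ} (l : Fin (k + 1))
    (F : (Fin (k + 1) → Fin n) → A) :
    ∑ j : Fin (k + 1) → Fin n, F j = ∑ i : Fin n, ∑ j' : Fin k → Fin n, F (l.insertNth i j') := by
  rw [← (Fin.insertNthEquiv (fun _ => Fin n) l).sum_comp, Fintype.sum_prod_type]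
  rfl

theorem Fin.sum_pi_filter_eq {A : Type*} [AddCommMonoid A] {k n : ℕ} (l : Fin (k + 1))
    (i : Fin n) (F : (Fin (k + 1) → Fin n) → A) :
    ∑ j : Fin (k + 1) → Fin n with j l = i, F j
      = ∑ j' : Fin k → Fin n, F (l.insertNth i j') := by
  rw [Finset.sum_filter, Fin.sum_pi_insertNth l]
  simp only [Fin.insertNth_apply_same]
  rw [Finset.sum_eq_single i (fun b _ hb => by simp [hb]) (by simp)]
  simp

/-- Littlewood's mixed `(1, 2, …, 2)` inequality for families of coefficients. -/
theorem sum_sqrt_sum_norm_sq_le_s2 {𝕂 ι : Type*} [RCLike 𝕂] [Fintype ι] {n : ℕ} {M : ℝ} (k : ℕ)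
    (c : ι → (Fin k → Fin n) → 𝕂)
    (hc : ∀ ε : Fin k → Fin n → ℝ, (∀ q i, ε q i = 1 ∨ ε q i = -1) →
      ∑ i, ‖∑ j, (∏ q, ε q (j q)) • c i j‖ ≤ M) :
    ∑ i, √(∑ j, ‖c i j‖ ^ 2) ≤ √2 ^ k * M := by
  induction k with
  | zero => simpa [Real.sqrt_sq] using hc Fin.elim0 fun q => q.elim0
  | succ k ih =>
    have hsplit := fun F : (Fin (k + 1) → Fin n) → 𝕂 => Fin.sum_pi_insertNth 0 F
    have hsplit' := fun F : (Fin (k + 1) → Fin n) → ℝ => Fin.sum_pi_insertNth 0 F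
    simp only [Fin.insertNth_zero'] at hsplit hsplit'
    let v (i : ι) (r : Fin n) : EuclideanSpace 𝕂 (Fin k → Fin n) :=
      WithLp.toLp 2 fun j' => c i (Fin.cons r j')
    have hmean : ∑ i, signMean n (fun x => ‖∑ r, x r • v i r‖) ≤ √2 ^ k * M := by
      rw [← signMean_sum, ← signMean_const n (√2 ^ k * M)]
      refine signMean_mono fun x hx => ?_
      have := ih (fun i j' => ∑ r, x r • c i (Fin.cons r j')) fun ε hε => by
        have := hc (Fin.cons x ε) (Fin.cases (by simpa using hx) (by simpa using hε))
        simp only [hsplit, Fin.prod_univ_succ, Fin.cons_zero, Fin.cons_succ] at this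
        refine le_of_eq_of_le (Finset.sum_congr rfl fun i _ => ?_) this
        rw [Finset.sum_comm]
        simp only [Finset.smul_sum, smul_smul, mul_comm]
      simpa [EuclideanSpace.norm_eq, v] using this
    calc ∑ i, √(∑ j, ‖c i j‖ ^ 2)
        = ∑ i, √(∑ r, ‖v i r‖ ^ 2) := by
          refine Finset.sum_congr rfl fun i _ => ?_
          simp only [EuclideanSpace.norm_sq_eq, v, hsplit']
      _ ≤ ∑ i, √2 * signMean n (fun x => ‖∑ r, x r • v i r‖) :=
          Finset.sum_le_sum fun i _ => sqrt_sum_norm_sq_le_signMean 𝕂 (v i)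
      _ ≤ √2 ^ (k + 1) * M := by
          rw [← Finset.mul_sum, pow_succ', mul_assoc]
          gcongr

theorem MultilinearMap.apply_eq_sum_prod_smul {𝕂 : Type*} [RCLike 𝕂] {m n : ℕ}
    (T : MultilinearMap 𝕂 (fun _ : Fin m => Fin n → 𝕂) 𝕂) (x : Fin m → Fin n → 𝕂) :
    T x = ∑ j : Fin m → Fin n, (∏ k, x k (j k)) * T (fun k => Pi.single (j k) 1) := by
  have hx : x = fun k => ∑ i, x k i • (Pi.single i 1 : Fin n → 𝕂) := by
    ext k i
    simp [Finset.sum_apply, Pi.single_apply]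
  conv_lhs => rw [hx, T.map_sum]
  exact Finset.sum_congr rfl fun j _ => by
    rw [T.map_smul_univ (fun k => x k (j k))]; rfl

theorem norm_apply_le_multilinearNorm {𝕂 : Type*} [RCLike 𝕂] {p : ℝ} (hp : 0 < p) {m n : ℕ}
    (T : MultilinearMap 𝕂 (fun _ : Fin m => Fin n → 𝕂) 𝕂) (x : Fin m → Fin n → 𝕂)
    (hx : ∀ k, ∑ i, ‖x k i‖ ^ p ≤ 1) : ‖T x‖ ≤ multilinearNorm 𝕂 p T := by
  refine le_csSup ⟨∑ j : Fin m → Fin n, ‖T (fun k => Pi.single (j k) 1)‖, ?_⟩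
    ⟨x, fun k => Real.rpow_le_one (Finset.sum_nonneg fun i _ => by positivity) (hx k)
      (by positivity), rfl⟩
  rintro t ⟨z, hz, rfl⟩
  have hz1 (k : Fin m) (i : Fin n) : ‖z k i‖ ≤ 1 := by
    have h0 : 0 ≤ ∑ i, ‖z k i‖ ^ p := Finset.sum_nonneg fun i _ => by positivity
    have h1 : ‖z k i‖ ^ p ≤ ∑ i, ‖z k i‖ ^ p :=
      Finset.single_le_sum (f := fun i => ‖z k i‖ ^ p) (fun i _ => by positivity)
        (Finset.mem_univ i)
    calc ‖z k i‖ = (‖z k i‖ ^ p) ^ (1 / p) := by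
          rw [← Real.rpow_mul (norm_nonneg _), mul_one_div_cancel hp.ne', Real.rpow_one]
      _ ≤ lpNorm 𝕂 p (z k) := Real.rpow_le_rpow (by positivity) h1 (by positivity)
      _ ≤ 1 := hz k
  rw [T.apply_eq_sum_prod_smul]
  refine (norm_sum_le _ _).trans (Finset.sum_le_sum fun j _ => ?_)
  rw [norm_mul, norm_prod]
  exact mul_le_of_le_one_left (norm_nonneg _)
    (Finset.prod_le_one (fun k _ => norm_nonneg _) fun k _ => hz1 k _)

/-- The weighted form of Littlewood's mixed inequality for forms on `ℓ_p^n × ⋯ × ℓ_p^n`. -/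
theorem sum_sqrt_sum_mul_prod_sq_le {𝕂 : Type*} [RCLike 𝕂] {p : ℝ} (hp : 0 < p) {k n : ℕ}
    (T : MultilinearMap 𝕂 (fun _ : Fin (k + 1) => Fin n → 𝕂) 𝕂)
    (y : Fin (k + 1) → Fin n → ℝ) (hy0 : ∀ q i, 0 ≤ y q i) (hy : ∀ q, ∑ i, y q i ^ p ≤ 1)
    (l : Fin (k + 1)) :
    ∑ i, √(∑ j : Fin (k + 1) → Fin n with j l = i,
        (‖T (fun q => Pi.single (j q) 1)‖ * ∏ q, y q (j q)) ^ 2)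
      ≤ √2 ^ k * multilinearNorm 𝕂 p T := by
  let b (j : Fin (k + 1) → Fin n) : 𝕂 := (∏ q, y q (j q)) • T (fun q => Pi.single (j q) 1)
  have hb (j) : ‖T (fun q => Pi.single (j q) 1)‖ * ∏ q, y q (j q) = ‖b j‖ := by
    simp only [b]
    rw [norm_smul, Real.norm_of_nonneg (Finset.prod_nonneg fun q _ => hy0 _ _), mul_comm]
  simp only [hb, Fin.sum_pi_filter_eq]
  refine sum_sqrt_sum_norm_sq_le_s2 k (fun i j' => b (l.insertNth i j')) fun ε hε => ?_
  have hun (z : 𝕂) : ∃ u : 𝕂, ‖u‖ = 1 ∧ u * z = ‖z‖ := by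
    by_cases hz : z = 0
    · exact ⟨1, by simp, by simp [hz]⟩
    · have hz' : (‖z‖ : 𝕂) ≠ 0 := by simpa using hz
      refine ⟨‖z‖ / z, ?_, by field_simp⟩
      simp [hz]
  choose θ hθ hθ' using fun i => hun (∑ j', (∏ q, ε q (j' q)) • b (l.insertNth i j'))
  let x : Fin (k + 1) → Fin n → 𝕂 := fun q i =>
    (y q i : 𝕂) * (l.insertNth θ (fun q i => (ε q i : 𝕂)) : Fin (k + 1) → Fin n → 𝕂) q i
  have hx (q) (i) : ‖x q i‖ = y q i := by
    have h1 : ‖(l.insertNth θ (fun q i => (ε q i : 𝕂)) : Fin (k + 1) → Fin n → 𝕂) q i‖ = 1 := by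
      refine Fin.succAboveCases l ?_ (fun q => ?_) q
      · simp [hθ]
      · rcases hε q i with h | h <;> simp [h]
    rw [norm_mul, h1, mul_one, RCLike.norm_ofReal, abs_of_nonneg (hy0 q i)]
  have hT : T x = ((∑ i, ‖∑ j', (∏ q, ε q (j' q)) • b (l.insertNth i j')‖ : ℝ) : 𝕂) := by
    rw [T.apply_eq_sum_prod_smul, Fin.sum_pi_insertNth l, RCLike.ofReal_sum]
    refine Finset.sum_congr rfl fun i _ => ?_
    rw [← hθ', Finset.mul_sum]
    refine Finset.sum_congr rfl fun j' _ => ?_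
    simp only [x, b, Finset.prod_mul_distrib]
    rw [Fin.prod_univ_succAbove _ l, Fin.prod_univ_succAbove _ l, Fin.prod_univ_succAbove _ l]
    simp only [Fin.insertNth_apply_same, Fin.insertNth_apply_succAbove, RCLike.real_smul_eq_coe_mul,
      RCLike.ofReal_mul, RCLike.ofReal_prod]
    ring
  have hle := norm_apply_le_multilinearNorm hp T x fun q => by simpa only [hx] using hy q
  rwa [hT, RCLike.norm_ofReal, abs_of_nonneg (Finset.sum_nonneg fun i _ => norm_nonneg _)] at hle

theorem Finset.sum_rpow_mul_rpow_le {ι : Type*} (s : Finset ι) {f g : ι → ℝ} {α β : ℝ}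
    (hf : ∀ i ∈ s, 0 ≤ f i) (hg : ∀ i ∈ s, 0 ≤ g i) (hα : 0 ≤ α) (hβ : 0 ≤ β) (hαβ : α + β = 1) :
    ∑ i ∈ s, f i ^ α * g i ^ β ≤ (∑ i ∈ s, f i) ^ α * (∑ i ∈ s, g i) ^ β := by
  rcases hα.eq_or_lt with rfl | hα'
  · obtain rfl : β = 1 := by linarith
    simp
  rcases hβ.eq_or_lt with rfl | hβ'
  · obtain rfl : α = 1 := by linarith
    simp
  have hpq : (1 / α).HolderConjugate (1 / β) := by
    rw [Real.holderConjugate_iff]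
    refine ⟨?_, by simpa using hαβ⟩
    rw [lt_div_iff₀ hα']
    linarith
  have h := Real.inner_le_Lp_mul_Lq_of_nonneg s hpq (f := fun i => f i ^ α) (g := fun i => g i ^ β)
    (fun i hi => Real.rpow_nonneg (hf i hi) _) fun i hi => Real.rpow_nonneg (hg i hi) _
  rw [one_div_one_div, one_div_one_div,
    Finset.sum_congr rfl fun i hi => show (f i ^ α) ^ (1 / α) = f i by
      rw [← Real.rpow_mul (hf i hi), mul_one_div_cancel hα'.ne', Real.rpow_one],
    Finset.sum_congr rfl fun i hi => show (g i ^ β) ^ (1 / β) = g i by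
      rw [← Real.rpow_mul (hg i hi), mul_one_div_cancel hβ'.ne', Real.rpow_one]] at h
  exact h

theorem Finset.sum_rpow_le_rpow_sum {ι : Type*} (s : Finset ι) {f : ι → ℝ} {r : ℝ}
    (hf : ∀ i ∈ s, 0 ≤ f i) (hr : 1 ≤ r) : ∑ i ∈ s, f i ^ r ≤ (∑ i ∈ s, f i) ^ r := by
  have hr0 : r ≠ 0 := by linarith
  have h0 := Finset.sum_nonneg hf
  have hsplit {x : ℝ} (hx : 0 ≤ x) : x ^ r = x * x ^ (r - 1) := by
    rw [← Real.rpow_one_add' hx (by simpa using hr0)]; ring_nf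
  rw [hsplit h0, Finset.sum_mul]
  refine Finset.sum_le_sum fun i hi => ?_
  rw [hsplit (hf i hi)]
  exact mul_le_mul_of_nonneg_left (Real.rpow_le_rpow (hf i hi)
    (Finset.single_le_sum hf hi) (by linarith)) (hf i hi)

/-- Converse of Hölder's inequality for weights in the unit ball of `ℓ_p`. -/
theorem sum_rpow_le_of_forall_weight {ι : Type*} [Fintype ι] {p s t C : ℝ} (hp : 0 < p)
    (hs : 0 < s) (ht : 0 < t) (hst : 1 / t = 1 / s - 1 / p) (hC : 0 ≤ C) {Q : ι → ℝ}
    (hQ : ∀ i, 0 ≤ Q i)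
    (h : ∀ w : ι → ℝ, (∀ i, 0 ≤ w i) → ∑ i, w i ^ p ≤ 1 → ∑ i, w i ^ s * Q i ≤ C ^ s) :
    ∑ i, Q i ^ (t / s) ≤ C ^ t := by
  set W := ∑ i, Q i ^ (t / s) with hW
  have hW0 : 0 ≤ W := Finset.sum_nonneg fun i _ => Real.rpow_nonneg (hQ i) _
  rcases hW0.eq_or_lt with hW0 | hW0
  · rw [← hW0]; positivity
  have hts : t / s = t / p + 1 := by
    field_simp at hst ⊢
    linarith
  have hst' : s / t = 1 - s / p := by
    field_simp at hst ⊢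
    linarith
  have key := h (fun i => (Q i ^ (t / s) / W) ^ (1 / p))
    (fun i => Real.rpow_nonneg (div_nonneg (Real.rpow_nonneg (hQ i) _) hW0.le) _) (by
      rw [Finset.sum_congr rfl fun i _ => show ((Q i ^ (t / s) / W) ^ (1 / p)) ^ p
          = Q i ^ (t / s) / W by
        rw [← Real.rpow_mul (div_nonneg (Real.rpow_nonneg (hQ i) _) hW0.le),
          one_div_mul_cancel hp.ne', Real.rpow_one], ← Finset.sum_div, div_self hW0.ne'])
  have hterm (i : ι) : ((Q i ^ (t / s) / W) ^ (1 / p)) ^ s * Q i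
      = Q i ^ (t / s) * W ^ (-(s / p)) := by
    rw [← Real.rpow_mul (div_nonneg (Real.rpow_nonneg (hQ i) _) hW0.le),
      Real.div_rpow (Real.rpow_nonneg (hQ i) _) hW0.le, ← Real.rpow_mul (hQ i),
      Real.rpow_neg hW0.le, hts, Real.rpow_add_one' (hQ i) (by positivity), ← hts]
    have e1 : t / s * (1 / p * s) = t / p := by field_simp
    have e2 : 1 / p * s = s / p := by ring
    rw [e1, e2]
    ring
  simp only [hterm] at key
  rw [← Finset.sum_mul, ← hW, ← Real.rpow_one_add' hW0.le (by
    rw [← sub_eq_add_neg, ← hst']; positivity), ← sub_eq_add_neg, ← hst'] at key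
  have := Real.rpow_le_rpow (by positivity) key (show 0 ≤ t / s by positivity)
  rwa [← Real.rpow_mul hW0.le, ← Real.rpow_mul hC, div_mul_div_cancel₀ ht.ne', div_self hs.ne',
    Real.rpow_one, mul_div_cancel₀ _ hs.ne'] at this

/-- Improvement of a weighted mixed inequality in which the weight depends on the outer index. -/
theorem sum_mixed_rpow_le_of_weight_outer {J B : Type*} [Fintype J] [Fintype B] [DecidableEq B]
    {p s t u C : ℝ} (hp : 0 < p) (hs : 0 < s) (ht : 0 < t) (hu : 0 < u)
    (hst : 1 / t = 1 / s - 1 / p) (hC : 0 ≤ C) (g : J → B) {b : J → ℝ} (hb : ∀ j, 0 ≤ b j)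
    (h : ∀ w : B → ℝ, (∀ i, 0 ≤ w i) → ∑ i, w i ^ p ≤ 1 →
      ∑ i, (∑ j with g j = i, (b j * w (g j)) ^ u) ^ (s / u) ≤ C ^ s) :
    ∑ i, (∑ j with g j = i, b j ^ u) ^ (t / u) ≤ C ^ t := by
  have hN (i : B) : 0 ≤ ∑ j with g j = i, b j ^ u :=
    Finset.sum_nonneg fun j _ => Real.rpow_nonneg (hb j) _
  have h1 := sum_rpow_le_of_forall_weight hp hs ht hst hC
    (Q := fun i => (∑ j with g j = i, b j ^ u) ^ (s / u)) (fun i => Real.rpow_nonneg (hN i) _)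
    fun w hw hw1 => by
      refine le_of_eq_of_le (Finset.sum_congr rfl fun i _ => ?_) (h w hw hw1)
      have hi : ∑ j with g j = i, (b j * w (g j)) ^ u = (∑ j with g j = i, b j ^ u) * w i ^ u := by
        rw [Finset.sum_mul]
        exact Finset.sum_congr rfl fun j hj => by
          rw [(Finset.mem_filter.1 hj).2, Real.mul_rpow (hb j) (hw i)]
      rw [hi, Real.mul_rpow (hN i) (Real.rpow_nonneg (hw i) _), ← Real.rpow_mul (hw i),
        mul_div_cancel₀ _ hu.ne', mul_comm]
  refine le_of_eq_of_le (Finset.sum_congr rfl fun i _ => ?_) h1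
  rw [← Real.rpow_mul (hN i)]
  congr 1
  field_simp

/-- Improvement of a weighted mixed inequality in which the weight depends on an inner index. -/
theorem sum_mixed_rpow_le_of_weight_inner {J A B : Type*} [Fintype J] [Fintype A] [Fintype B]
    [DecidableEq A] [DecidableEq B] {p s t u C : ℝ} (hp : 0 < p) (hs : 0 < s) (hs_t : s < t)
    (htu : t ≤ u) (hst : 1 / t = 1 / s - 1 / p) (hC : 0 ≤ C) (f : J → A) (g : J → B)
    {b : J → ℝ} (hb : ∀ j, 0 ≤ b j)
    (h1 : ∀ w : B → ℝ, (∀ i, 0 ≤ w i) → ∑ i, w i ^ p ≤ 1 →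
      ∑ i, (∑ j with f j = i, (b j * w (g j)) ^ u) ^ (s / u) ≤ C ^ s)
    (h2 : ∑ i, (∑ j with g j = i, b j ^ u) ^ (t / u) ≤ C ^ t) :
    ∑ i, (∑ j with f j = i, b j ^ u) ^ (t / u) ≤ C ^ t := by
  have ht : 0 < t := hs.trans hs_t
  have hu : 0 < u := ht.trans_le htu
  have hus : 0 < u - s := by linarith
  obtain ⟨β, hβ⟩ : ∃ β : J → ℝ, ∀ j, β j = b j ^ u := ⟨_, fun _ => rfl⟩
  have hβ0 (j) : 0 ≤ β j := by rw [hβ]; exact Real.rpow_nonneg (hb j) _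
  simp only [← hβ] at h2 ⊢
  set S : A → ℝ := fun i => ∑ j with f j = i, β j with hS
  set R : B → ℝ := fun i => ∑ j with g j = i, β j with hR
  have hS0 (i) : 0 ≤ S i := Finset.sum_nonneg fun j _ => hβ0 j
  have hR0 (i) : 0 ≤ R i := Finset.sum_nonneg fun j _ => hβ0 j
  set Q : B → ℝ := fun i => ∑ j with g j = i, β j * S (f j) ^ (s / u - 1) with hQ
  have hQj (j) : 0 ≤ β j * S (f j) ^ (s / u - 1) := mul_nonneg (hβ0 j) (Real.rpow_nonneg (hS0 _) _)
  have hQ0 (i) : 0 ≤ Q i := Finset.sum_nonneg fun j _ => hQj j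
  have hQle : ∑ i, Q i ^ (t / s) ≤ C ^ t := by
    refine sum_rpow_le_of_forall_weight hp hs ht hst hC hQ0 fun w hw hw1 => ?_
    refine le_trans ?_ (h1 w hw hw1)
    calc ∑ i, w i ^ s * Q i
        = ∑ j, w (g j) ^ s * (β j * S (f j) ^ (s / u - 1)) := by
          rw [← Finset.sum_fiberwise _ g]
          refine Finset.sum_congr rfl fun i _ => ?_
          rw [hQ, Finset.mul_sum]
          exact Finset.sum_congr rfl fun j hj => by rw [(Finset.mem_filter.1 hj).2]
      _ = ∑ i, (∑ j with f j = i, w (g j) ^ s * β j) * S i ^ (s / u - 1) := by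
          rw [← Finset.sum_fiberwise _ f]
          refine Finset.sum_congr rfl fun i _ => ?_
          rw [Finset.sum_mul]
          exact Finset.sum_congr rfl fun j hj => by rw [(Finset.mem_filter.1 hj).2, mul_assoc]
      _ ≤ ∑ i, (∑ j with f j = i, (b j * w (g j)) ^ u) ^ (s / u) := by
          refine Finset.sum_le_sum fun i _ => ?_
          have hV0 : 0 ≤ ∑ j with f j = i, (b j * w (g j)) ^ u :=
            Finset.sum_nonneg fun j _ => Real.rpow_nonneg (mul_nonneg (hb j) (hw _)) _
          have hsu : 0 ≤ s / u := by positivity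
          have hsu' : 0 ≤ 1 - s / u := by
            rw [sub_nonneg, div_le_one hu]; linarith
          have hh := Finset.sum_rpow_mul_rpow_le (Finset.univ.filter fun j => f j = i)
            (f := fun j => (b j * w (g j)) ^ u) (g := β)
            (fun j _ => Real.rpow_nonneg (mul_nonneg (hb j) (hw _)) _) (fun j _ => hβ0 j)
            hsu hsu' (by ring)
          have hterm (j) : ((b j * w (g j)) ^ u) ^ (s / u) * β j ^ (1 - s / u)
              = w (g j) ^ s * β j := by
            rw [Real.mul_rpow (hb j) (hw _), ← hβ,
              Real.mul_rpow (hβ0 j) (Real.rpow_nonneg (hw _) _), ← Real.rpow_mul (hw _),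
              mul_div_cancel₀ _ hu.ne', mul_comm (β j ^ (s / u)), mul_assoc,
              ← Real.rpow_add_of_nonneg (hβ0 j) hsu hsu', add_sub_cancel, Real.rpow_one]
          simp only [hterm] at hh
          rcases (hS0 i).eq_or_lt with hSi | hSi
          · rw [← hSi, Real.zero_rpow, mul_zero]
            · exact Real.rpow_nonneg hV0 _
            · rw [div_sub_one hu.ne']
              exact div_ne_zero (by linarith) hu.ne'
          · calc _ ≤ _ := mul_le_mul_of_nonneg_right hh (Real.rpow_nonneg hSi.le (s / u - 1))
              _ = _ := by
                rw [mul_assoc, ← Real.rpow_add hSi]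
                simp
  obtain ⟨θ, hθ⟩ : ∃ θ, θ = (t - s) / (u - s) := ⟨_, rfl⟩
  have hθ0 : 0 ≤ θ := by rw [hθ]; exact div_nonneg (by linarith) hus.le
  have hθ1 : 0 ≤ 1 - θ := by
    rw [hθ, sub_nonneg, div_le_one hus]; linarith
  have hθt : θ * u + (1 - θ) * s = t := by
    rw [hθ]; field_simp; ring
  calc ∑ i, S i ^ (t / u) = ∑ i, ∑ j with f j = i, β j * S (f j) ^ (t / u - 1) := by
        refine Finset.sum_congr rfl fun i _ => ?_
        rw [Finset.sum_congr rfl fun j hj => by rw [(Finset.mem_filter.1 hj).2], ← Finset.sum_mul]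
        change _ = S i * _
        rw [← Real.rpow_one_add' (hS0 i) (by rw [add_sub_cancel]; positivity), add_sub_cancel]
    _ = ∑ i, ∑ j with g j = i, β j * S (f j) ^ (t / u - 1) := by
        rw [Finset.sum_fiberwise, Finset.sum_fiberwise]
    _ = ∑ i, ∑ j with g j = i, β j ^ θ * (β j * S (f j) ^ (s / u - 1)) ^ (1 - θ) := by
        refine Finset.sum_congr rfl fun i _ => Finset.sum_congr rfl fun j _ => ?_
        rw [Real.mul_rpow (hβ0 j) (Real.rpow_nonneg (hS0 _) _), ← mul_assoc,
          ← Real.rpow_add_of_nonneg (hβ0 j) hθ0 hθ1, add_sub_cancel, Real.rpow_one,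
          ← Real.rpow_mul (hS0 _)]
        congr 2
        rw [← hθt]
        field_simp
        ring
    _ ≤ ∑ i, R i ^ θ * Q i ^ (1 - θ) := Finset.sum_le_sum fun i _ =>
        Finset.sum_rpow_mul_rpow_le _ (fun j _ => hβ0 j) (fun j _ => hQj j) hθ0 hθ1 (by ring)
    _ = ∑ i, (R i ^ (t / u)) ^ (θ * u / t) * (Q i ^ (t / s)) ^ ((1 - θ) * s / t) := by
        refine Finset.sum_congr rfl fun i _ => ?_
        rw [← Real.rpow_mul (hR0 i), ← Real.rpow_mul (hQ0 i)]
        congr 2 <;> field_simp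
    _ ≤ (∑ i, R i ^ (t / u)) ^ (θ * u / t) * (∑ i, Q i ^ (t / s)) ^ ((1 - θ) * s / t) :=
        Finset.sum_rpow_mul_rpow_le _ (fun i _ => Real.rpow_nonneg (hR0 i) _)
          (fun i _ => Real.rpow_nonneg (hQ0 i) _) (by positivity) (by positivity)
          (by rw [← add_div, hθt, div_self ht.ne'])
    _ ≤ (C ^ t) ^ (θ * u / t) * (C ^ t) ^ ((1 - θ) * s / t) :=
        mul_le_mul
          (Real.rpow_le_rpow (Finset.sum_nonneg fun i _ => Real.rpow_nonneg (hR0 i) _) h2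
            (by positivity))
          (Real.rpow_le_rpow (Finset.sum_nonneg fun i _ => Real.rpow_nonneg (hQ0 i) _) hQle
            (by positivity))
          (Real.rpow_nonneg (Finset.sum_nonneg fun i _ => Real.rpow_nonneg (hQ0 i) _) _)
          (by positivity)
    _ = C ^ t := by
        rw [← Real.rpow_add_of_nonneg (by positivity) (by positivity) (by positivity),
          ← add_div, hθt, div_self ht.ne', Real.rpow_one]

/-- Families of nonnegative weights, trivial in the slots below `k` and in the unit ball of `ℓ_p`
in the other slots. -/
def IsWeightFrom (p : ℝ) {m n : ℕ} (k : ℕ) (y : Fin m → Fin n → ℝ) : Prop :=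
  ∀ q : Fin m, (∀ i, 0 ≤ y q i) ∧ (q < k → y q = 1) ∧ (k ≤ q → ∑ i, y q i ^ p ≤ 1)

theorem IsWeightFrom.update {p : ℝ} {m n : ℕ} {k : Fin m} {y : Fin m → Fin n → ℝ}
    (hy : IsWeightFrom p (k + 1) y) {w : Fin n → ℝ} (hw : ∀ i, 0 ≤ w i)
    (hw1 : ∑ i, w i ^ p ≤ 1) : IsWeightFrom p k (Function.update y k w) := by
  intro q
  by_cases hq : q = k
  · subst hq
    simpa using ⟨hw, hw1⟩
  · have hq' : (q : ℕ) ≠ k := fun h => hq (Fin.ext h)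
    rw [Function.update_of_ne hq]
    exact ⟨(hy q).1, fun h => (hy q).2.1 (by omega), fun h => (hy q).2.2 (by omega)⟩

theorem IsWeightFrom.prod_update {p : ℝ} {m n : ℕ} {k : Fin m} {y : Fin m → Fin n → ℝ}
    (hy : IsWeightFrom p (k + 1) y) (w : Fin n → ℝ) (j : Fin m → Fin n) :
    ∏ q, Function.update y k w q (j q) = (∏ q, y q (j q)) * w (j k) := by
  rw [← Finset.prod_erase_mul _ _ (Finset.mem_univ k), Function.update_self,
    ← Finset.prod_erase_mul _ (fun q => y q (j q)) (Finset.mem_univ k), (hy k).2.1 (by simp),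
    Pi.one_apply, mul_one]
  congr 1
  exact Finset.prod_congr rfl fun q hq => by
    rw [Function.update_of_ne (Finset.ne_of_mem_erase hq)]

theorem IsWeightFrom.prod_nonneg {p : ℝ} {m n k : ℕ} {y : Fin m → Fin n → ℝ}
    (hy : IsWeightFrom p k y) (j : Fin m → Fin n) : 0 ≤ ∏ q, y q (j q) :=
  Finset.prod_nonneg fun q _ => (hy q).1 _

/-- The passage from weighted mixed `(1, 2, …, 2)` inequalities to an `ℓ_{p/(p-m)}` estimate. -/
theorem sum_rpow_le_of_mixed {m n : ℕ} {p C : ℝ} (hp1 : (m : ℝ) < p) (hp2 : p < 2 * m)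
    (hC : 0 ≤ C) {a : (Fin m → Fin n) → ℝ} (ha : ∀ j, 0 ≤ a j)
    (h : ∀ y : Fin m → Fin n → ℝ, IsWeightFrom p 0 y → ∀ l : Fin m,
      ∑ i : Fin n, √(∑ j : Fin m → Fin n with j l = i, (a j * ∏ q, y q (j q)) ^ 2) ≤ C) :
    ∑ j, a j ^ (p / (p - m)) ≤ C ^ (p / (p - m)) := by
  have hp : 0 < p := (Nat.cast_nonneg m).trans_lt hp1
  have hexp {k : ℕ} (hk : k < m) : 0 < p / (p - k) ∧ p / (p - k) < p / (p - (k + 1 : ℕ)) ∧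
      1 / (p / (p - (k + 1 : ℕ))) = 1 / (p / (p - k)) - 1 / p := by
    have h1 : ((k + 1 : ℕ) : ℝ) ≤ m := by exact_mod_cast hk
    push_cast at h1 ⊢
    have h2 : 0 < p - (k + 1) := by linarith
    have h3 : 0 < p - k := by linarith
    refine ⟨by positivity, ?_, ?_⟩
    · exact div_lt_div_of_pos_left hp h2 (by linarith)
    · field_simp
      ring
  have main (k : ℕ) (hk : k ≤ m) :
      (2 * k ≤ p → ∀ y : Fin m → Fin n → ℝ, IsWeightFrom p k y → ∀ l : Fin m,
        ∑ i : Fin n, (∑ j : Fin m → Fin n with j l = i,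
          (a j * ∏ q, y q (j q)) ^ (2 : ℝ)) ^ (p / (p - k) / 2) ≤ C ^ (p / (p - k))) ∧
      (p < 2 * k → ∀ y : Fin m → Fin n → ℝ, IsWeightFrom p k y →
        ∑ j, (a j * ∏ q, y q (j q)) ^ (p / (p - k)) ≤ C ^ (p / (p - k))) := by
    induction k with
    | zero =>
      refine ⟨fun _ y hy l => ?_, fun h0 => absurd h0 (by simpa using hp.le)⟩
      simpa [hp.ne', Real.sqrt_eq_rpow] using h y hy l
    | succ k ih =>
      have ih := ih (by omega)
      obtain ⟨κ, rfl⟩ : ∃ κ : Fin m, (κ : ℕ) = k := ⟨⟨k, hk⟩, rfl⟩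
      obtain ⟨hs, hst, hinv⟩ := hexp hk
      have ht := hs.trans hst
      generalize hs_def : p / (p - (κ : ℕ)) = s at *
      generalize ht_def : p / (p - ((κ : ℕ) + 1 : ℕ)) = t at *
      have hk1 : (((κ : ℕ) + 1 : ℕ) : ℝ) ≤ m := by exact_mod_cast hk
      have hbase (y : Fin m → Fin n → ℝ) (hy : IsWeightFrom p (κ + 1) y) (j : Fin m → Fin n) :
          0 ≤ a j * ∏ q, y q (j q) := mul_nonneg (ha j) (hy.prod_nonneg j)
      have outer (hk2 : 2 * ((κ : ℕ) : ℝ) ≤ p) (y : Fin m → Fin n → ℝ)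
          (hy : IsWeightFrom p (κ + 1) y) :
          ∑ i : Fin n, (∑ j : Fin m → Fin n with j κ = i,
            (a j * ∏ q, y q (j q)) ^ (2 : ℝ)) ^ (t / 2) ≤ C ^ t :=
        sum_mixed_rpow_le_of_weight_outer hp hs ht two_pos hinv hC (fun j => j κ)
          (b := fun j => a j * ∏ q, y q (j q)) (hbase y hy)
          fun w hw hw1 => by
            have := ih.1 hk2 _ (hy.update hw hw1) κ
            simpa only [hy.prod_update, ← mul_assoc] using this
      constructor
      · intro hk2 y hy l
        have hk2' : 2 * ((κ : ℕ) : ℝ) ≤ p := by push_cast at hk2; linarith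
        have ht2 : t ≤ 2 := by
          rw [← ht_def, div_le_iff₀ (by linarith)]
          linarith
        refine sum_mixed_rpow_le_of_weight_inner hp hs hst ht2 hinv hC (fun j => j l)
          (fun j => j κ)
          (b := fun j => a j * ∏ q, y q (j q)) (hbase y hy) (fun w hw hw1 => ?_) (outer hk2' y hy)
        have := ih.1 hk2' _ (hy.update hw hw1) l
        simpa only [hy.prod_update, ← mul_assoc] using this
      · intro hk2 y hy
        obtain ⟨u, hu, hut, hle⟩ : ∃ u, 0 < u ∧ u ≤ t ∧
            ∑ i : Fin n, (∑ j : Fin m → Fin n with j κ = i,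
              (a j * ∏ q, y q (j q)) ^ u) ^ (t / u) ≤ C ^ t := by
          rcases le_or_gt (2 * ((κ : ℕ) : ℝ)) p with hk2' | hk2'
          · refine ⟨2, two_pos, ?_, outer hk2' y hy⟩
            rw [← ht_def, le_div_iff₀ (by linarith)]
            linarith
          · refine ⟨s, hs, hst.le, ?_⟩
            refine sum_mixed_rpow_le_of_weight_outer hp hs ht hs hinv hC (fun j => j κ)
              (b := fun j => a j * ∏ q, y q (j q))
              (hbase y hy) fun w hw hw1 => ?_
            have := ih.2 hk2' _ (hy.update hw hw1)
            simpa only [hy.prod_update, ← mul_assoc, div_self hs.ne',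
              Real.rpow_one, Finset.sum_fiberwise] using this
        refine le_trans ?_ hle
        rw [← Finset.sum_fiberwise _ fun j => j κ]
        refine Finset.sum_le_sum fun i _ => ?_
        refine le_of_eq_of_le (Finset.sum_congr rfl fun j _ => ?_)
          (Finset.sum_rpow_le_rpow_sum _ (fun j _ => Real.rpow_nonneg (hbase y hy j) u)
            ((one_le_div hu).2 hut))
        rw [← Real.rpow_mul (hbase y hy j), mul_div_cancel₀ _ hu.ne']
  have hfin := (main m le_rfl).2 hp2 (fun _ _ => 1) fun q =>
    ⟨fun _ => zero_le_one, fun _ => rfl, fun hq => absurd q.2 (by omega)⟩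
  simpa using hfin

theorem hardy_littlewood_dimant_sevilla_peris
    (𝕂 : Type*) [RCLike 𝕂] (m : ℕ) (hm : 2 ≤ m) (p : ℝ)
    (hp1 : (m : ℝ) < p) (hp2 : p < 2 * m)
    (n : ℕ) (hn : 0 < n)
    (T : MultilinearMap 𝕂 (fun _ : Fin m => Fin n → 𝕂) 𝕂) :
    (∑ j : Fin m → Fin n, ‖T (fun k => Pi.single (j k) (1 : 𝕂))‖ ^ (p / (p - m))) ^ ((p - m) / p)
      ≤ Real.sqrt 2 ^ (m - 1) * multilinearNorm 𝕂 p T := by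
  obtain ⟨m, rfl⟩ : ∃ k, m = k + 1 := ⟨m - 1, by omega⟩
  have hp : 0 < p := (Nat.cast_nonneg _).trans_lt hp1
  have hpm : 0 < p - (m + 1 : ℕ) := by linarith
  have hC : 0 ≤ √2 ^ (m + 1 - 1) * multilinearNorm 𝕂 p T :=
    mul_nonneg (by positivity) (Real.sSup_nonneg fun t ⟨x, _, hx⟩ => hx ▸ norm_nonneg _)
  have h := sum_rpow_le_of_mixed hp1 hp2 hC
    (a := fun j => ‖T (fun k => Pi.single (j k) (1 : 𝕂))‖) (fun j => norm_nonneg _)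
    fun y hy l => sum_sqrt_sum_mul_prod_sq_le hp T y (fun q => (hy q).1)
      (fun q => (hy q).2.2 (Nat.zero_le _)) l
  have h' := Real.rpow_le_rpow (Finset.sum_nonneg fun j _ => by positivity) h
    (show 0 ≤ (p - (m + 1 : ℕ)) / p by positivity)
  rwa [← Real.rpow_mul hC, div_mul_div_cancel₀ hpm.ne', div_self hp.ne', Real.rpow_one] at h'
end

section
/- Let m ≥ 2 be an integer and let p be a real number with m < p < 2m. If ρ > 0 and C > 0 are such that for every positive integer n and every m-linear form T : ℓ_p^n × ⋯ × ℓ_p^n → 𝕂 (𝕂 = ℝ or ℂ) one has (∑_{j_1,…,j_m=1}^n |T(e_{j_1},…,e_{j_m})|^ρ)^{1/ρ} ≤ C‖T‖, then ρ ≥ p/(p − m). -/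
open scoped BigOperators

/-- The diagonal form `(x₁, …, xₘ) ↦ ∑ i, x₁ i ⋯ xₘ i`. -/
noncomputable def diagonalForm (𝕂 : Type*) [RCLike 𝕂] (m n : ℕ) :
    MultilinearMap 𝕂 (fun _ : Fin m => Fin n → 𝕂) 𝕂 :=
  ∑ i : Fin n, (MultilinearMap.mkPiAlgebra 𝕂 (Fin m) 𝕂).compLinearMap
    (fun _ => LinearMap.proj i)

lemma diagonalForm_apply (𝕂 : Type*) [RCLike 𝕂] (m n : ℕ) (x : Fin m → Fin n → 𝕂) :
    diagonalForm 𝕂 m n x = ∑ i, ∏ k, x k i := by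
  simp [diagonalForm]

lemma sum_rpow_le_one_of_lpNorm_le_one {𝕂 : Type*} [RCLike 𝕂] {p : ℝ} (hp : 0 < p) {n : ℕ}
    {x : Fin n → 𝕂} (hx : lpNorm 𝕂 p x ≤ 1) : ∑ i, ‖x i‖ ^ p ≤ 1 := by
  by_contra! hlt
  exact absurd hx (not_le.mpr (Real.one_lt_rpow hlt (by positivity)))

lemma prod_le_weighted_sum_rpow {m : ℕ} {p : ℝ} (hp : 0 < p) (hmp : (m : ℝ) ≤ p) {t : ℝ}
    (ht : 0 < t) (a : Fin m → ℝ) (ha : ∀ k, 0 ≤ a k) :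
    ∏ k, a k ≤ t ^ (1 - m / p) * (∑ k, 1 / p * a k ^ p + (1 - m / p) * t⁻¹) := by
  have hw : 0 ≤ 1 - m / p := sub_nonneg.mpr ((div_le_one hp).mpr hmp)
  have key := Real.geom_mean_le_arith_mean_weighted (Finset.univ : Finset (Option (Fin m)))
    (fun o => o.elim (1 - m / p) fun _ => 1 / p) (fun o => o.elim t⁻¹ fun k => a k ^ p)
    (by rintro (_ | k) _ <;> simp <;> first | simpa using hw | positivity)
    (by simp [Fintype.sum_option, div_eq_mul_inv])
    (by
      rintro (_ | k) _
      · simpa using ht.le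
      · exact Real.rpow_nonneg (ha k) p)
  simp only [Fintype.prod_option, Fintype.sum_option, Option.elim] at key
  have hroot : ∀ k, (a k ^ p) ^ (1 / p) = a k := fun k => by
    rw [one_div, Real.rpow_rpow_inv (ha k) hp.ne']
  simp only [hroot] at key
  rw [Real.inv_rpow ht.le, inv_mul_le_iff₀ (Real.rpow_pos_of_pos ht _)] at key
  rwa [add_comm (∑ k, _)]

lemma multilinearNorm_diagonalForm_le (𝕂 : Type*) [RCLike 𝕂] {m n : ℕ} {p : ℝ} (hp : 0 < p)
    (hmp : (m : ℝ) ≤ p) (hn : 0 < n) :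
    multilinearNorm 𝕂 p (diagonalForm 𝕂 m n) ≤ (n : ℝ) ^ (1 - m / p) := by
  have hn' : (0 : ℝ) < n := Nat.cast_pos.mpr hn
  refine Real.sSup_le ?_ (by positivity)
  rintro _ ⟨x, hx, rfl⟩
  rw [diagonalForm_apply]
  calc ‖∑ i, ∏ k, x k i‖ ≤ ∑ i, ∏ k, ‖x k i‖ := by
        refine (norm_sum_le _ _).trans_eq ?_
        simp only [norm_prod]
    _ ≤ ∑ i, (n : ℝ) ^ (1 - m / p) *
          (∑ k, 1 / p * ‖x k i‖ ^ p + (1 - m / p) * (n : ℝ)⁻¹) :=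
        Finset.sum_le_sum fun i _ =>
          prod_le_weighted_sum_rpow hp hmp hn' _ fun k => norm_nonneg _
    _ = (n : ℝ) ^ (1 - m / p) *
          (∑ k, 1 / p * ∑ i, ‖x k i‖ ^ p + (1 - m / p)) := by
        rw [← Finset.mul_sum, Finset.sum_add_distrib, Finset.sum_comm]
        simp only [Finset.mul_sum, Finset.sum_const, Finset.card_univ, Fintype.card_fin,
          nsmul_eq_mul]
        rw [mul_left_comm (n : ℝ), mul_inv_cancel₀ hn'.ne', mul_one]
    _ ≤ (n : ℝ) ^ (1 - m / p) * (∑ _k : Fin m, 1 / p * 1 + (1 - m / p)) := by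
        gcongr with k
        exact sum_rpow_le_one_of_lpNorm_le_one hp (hx k)
    _ = (n : ℝ) ^ (1 - m / p) := by
        simp [div_eq_mul_inv]

lemma natCast_le_sum_diagonalForm_rpow (𝕂 : Type*) [RCLike 𝕂] {m : ℕ} (hm : 0 < m) (n : ℕ)
    (ρ : ℝ) :
    (n : ℝ) ≤ ∑ j : Fin m → Fin n,
      ‖diagonalForm 𝕂 m n (fun k => Pi.single (j k) (1 : 𝕂))‖ ^ ρ := by
  have : Nonempty (Fin m) := ⟨⟨0, hm⟩⟩
  have hval : ∀ i : Fin n,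
      ‖diagonalForm 𝕂 m n (fun _ => Pi.single i (1 : 𝕂))‖ ^ ρ = 1 := fun i => by
    simp [diagonalForm_apply, Pi.single_apply, hm.ne']
  calc (n : ℝ) = ∑ i : Fin n, ‖diagonalForm 𝕂 m n (fun _ => Pi.single i (1 : 𝕂))‖ ^ ρ := by
        simp [hval]
    _ = ∑ j ∈ Finset.univ.map ⟨Function.const (Fin m), Function.const_injective⟩,
          ‖diagonalForm 𝕂 m n (fun k => Pi.single (j k) (1 : 𝕂))‖ ^ ρ := by
        simp
    _ ≤ _ := Finset.sum_le_sum_of_subset_of_nonneg (Finset.subset_univ _)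
        fun _ _ _ => by positivity

lemma le_of_forall_natCast_rpow_le {a b C : ℝ}
    (h : ∀ n : ℕ, 0 < n → (n : ℝ) ^ a ≤ C * (n : ℝ) ^ b) : a ≤ b := by
  by_contra! hlt
  have hlim := (tendsto_rpow_atTop (sub_pos.mpr hlt)).comp tendsto_natCast_atTop_atTop
  obtain ⟨n, hnC, hn⟩ :=
    ((hlim.eventually_gt_atTop C).and (Filter.eventually_gt_atTop 0)).exists
  have hn' : (0 : ℝ) < n := Nat.cast_pos.mpr hn
  simp only [Function.comp_apply, Real.rpow_sub hn'] at hnC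
  rw [lt_div_iff₀ (Real.rpow_pos_of_pos hn' b)] at hnC
  exact absurd (h n hn) (not_le.mpr hnC)

theorem hardy_littlewood_dimant_sevilla_peris_optimal
    (𝕂 : Type*) [RCLike 𝕂] (m : ℕ) (hm : 2 ≤ m) (p : ℝ)
    (hp1 : (m : ℝ) < p) (hp2 : p < 2 * m)
    (ρ C : ℝ) (hρ : 0 < ρ) (hC : 0 < C)
    (h : ∀ n : ℕ, 0 < n → ∀ T : MultilinearMap 𝕂 (fun _ : Fin m => Fin n → 𝕂) 𝕂,
      (∑ j : Fin m → Fin n, ‖T (fun k => Pi.single (j k) (1 : 𝕂))‖ ^ ρ) ^ (1 / ρ)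
        ≤ C * multilinearNorm 𝕂 p T) :
    p / (p - m) ≤ ρ := by
  have hp : 0 < p := (Nat.cast_nonneg m).trans_lt hp1
  have hexp : 1 / ρ ≤ 1 - m / p := le_of_forall_natCast_rpow_le (C := C) fun n hn =>
    calc (n : ℝ) ^ (1 / ρ) ≤ _ := Real.rpow_le_rpow (Nat.cast_nonneg n)
          (natCast_le_sum_diagonalForm_rpow 𝕂 (by omega) n ρ) (by positivity)
      _ ≤ C * multilinearNorm 𝕂 p (diagonalForm 𝕂 m n) := h n hn _
      _ ≤ C * (n : ℝ) ^ (1 - m / p) :=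
          mul_le_mul_of_nonneg_left (multilinearNorm_diagonalForm_le 𝕂 hp hp1.le hn) hC.le
  have hpm : 0 < p - m := sub_pos.mpr hp1
  rw [one_sub_div hp.ne', div_le_div_iff₀ hρ hp, one_mul] at hexp
  rw [div_le_iff₀ hpm]
  linarith
end

section
/- There do not exist a real number r ∈ [1, ∞) and a constant C > 0 such that (∑_{|α|=2} |a_α|^r)^{1/r} ≤ C‖P‖ holds for every positive integer n and every 2-homogeneous polynomial P(x) = ∑_{|α|=2} a_α x^α on ℓ_2^n (𝕂 = ℝ or ℂ). -/
open scoped BigOperators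

/-- The sup norm of a polynomial on the unit ball of `ℓ_p^n`. -/
noncomputable def polyNorm (𝕂 : Type*) [RCLike 𝕂] (p : ℝ) {n : ℕ}
    (P : MvPolynomial (Fin n) 𝕂) : ℝ :=
  sSup {t : ℝ | ∃ x : Fin n → 𝕂, lpNorm 𝕂 p x ≤ 1 ∧ t = ‖MvPolynomial.eval x P‖}

/-- The sum of squares `∑ i, X i ^ 2` has norm at most one on the unit ball of `ℓ_2^n`. -/
lemma polyNorm_two_sum_sq_le_one (𝕂 : Type*) [RCLike 𝕂] (n : ℕ) :
    polyNorm 𝕂 2 (∑ i : Fin n, (MvPolynomial.X i : MvPolynomial (Fin n) 𝕂) ^ 2) ≤ 1 := by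
  refine Real.sSup_le ?_ zero_le_one
  rintro t ⟨x, hx, rfl⟩
  have hsum : ∑ i, ‖x i‖ ^ (2 : ℝ) ≤ 1 := by
    rw [lpNorm] at hx
    by_contra! h
    exact absurd hx (not_le.mpr (Real.one_lt_rpow h (by norm_num)))
  simp only [map_sum, map_pow, MvPolynomial.eval_X]
  refine (norm_sum_le _ _).trans (le_trans (le_of_eq ?_) hsum)
  exact Finset.sum_congr rfl fun i _ => by rw [norm_pow, Real.rpow_two]

/-- The coefficient of `X i ^ 2` in the sum of squares is one. -/
lemma coeff_single_two_sum_sq {𝕂 : Type*} [RCLike 𝕂] {n : ℕ} (i : Fin n) :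
    MvPolynomial.coeff (Finsupp.single i 2)
      (∑ j : Fin n, (MvPolynomial.X j : MvPolynomial (Fin n) 𝕂) ^ 2) = 1 := by
  classical
  simp [MvPolynomial.coeff_sum, MvPolynomial.coeff_X_pow, Finsupp.single_left_inj]

/-- The `r`-th powers of the coefficients of the sum of squares add up to at least `n`. -/
lemma le_sum_coeff_rpow_sum_sq (𝕂 : Type*) [RCLike 𝕂] (n : ℕ) (r : ℝ) :
    (n : ℝ) ≤ ∑ α ∈ (∑ i : Fin n, (MvPolynomial.X i : MvPolynomial (Fin n) 𝕂) ^ 2).support,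
      ‖MvPolynomial.coeff α
        (∑ i : Fin n, (MvPolynomial.X i : MvPolynomial (Fin n) 𝕂) ^ 2)‖ ^ r := by
  classical
  have hinj : Function.Injective fun i : Fin n => Finsupp.single i 2 :=
    Finsupp.single_left_injective two_ne_zero
  calc (n : ℝ)
      = ∑ α ∈ Finset.univ.image (fun i : Fin n => Finsupp.single i 2),
          ‖MvPolynomial.coeff α
            (∑ i : Fin n, (MvPolynomial.X i : MvPolynomial (Fin n) 𝕂) ^ 2)‖ ^ r := by
        rw [Finset.sum_image hinj.injOn]
        simp only [coeff_single_two_sum_sq]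
        simp
    _ ≤ _ := by
        refine Finset.sum_le_sum_of_subset_of_nonneg ?_ fun _ _ _ => by positivity
        intro α hα
        obtain ⟨i, -, rfl⟩ := Finset.mem_image.mp hα
        rw [MvPolynomial.mem_support_iff, coeff_single_two_sum_sq]
        exact one_ne_zero

theorem no_ell_r_HL_for_two_homogeneous_on_ell_two (𝕂 : Type*) [RCLike 𝕂] :
    ¬ ∃ r : ℝ, 1 ≤ r ∧ ∃ C : ℝ, 0 < C ∧
      ∀ n : ℕ, 0 < n → ∀ P : MvPolynomial (Fin n) 𝕂, P.IsHomogeneous 2 →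
        (∑ α ∈ P.support, ‖MvPolynomial.coeff α P‖ ^ r) ^ (1 / r) ≤ C * polyNorm 𝕂 2 P := by
  rintro ⟨r, hr, C, hC, h⟩
  have hr0 : 0 < r := by linarith
  obtain ⟨n, hn⟩ := exists_nat_gt (C ^ r)
  have hn0 : 0 < n := by exact_mod_cast (Real.rpow_pos_of_pos hC r).trans hn
  have hP := h n hn0 (∑ i : Fin n, MvPolynomial.X i ^ 2)
    (MvPolynomial.IsHomogeneous.sum _ _ _ fun i _ => MvPolynomial.isHomogeneous_X_pow i 2)
  have hle : (n : ℝ) ^ (1 / r) ≤ C :=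
    calc (n : ℝ) ^ (1 / r) ≤ _ :=
          Real.rpow_le_rpow n.cast_nonneg (le_sum_coeff_rpow_sum_sq 𝕂 n r) (by positivity)
      _ ≤ _ := hP
      _ ≤ C * 1 := mul_le_mul_of_nonneg_left (polyNorm_two_sum_sq_le_one 𝕂 n) hC.le
      _ = C := mul_one C
  have hpow := Real.rpow_le_rpow (by positivity) hle hr0.le
  rw [← Real.rpow_mul n.cast_nonneg, one_div_mul_cancel hr0.ne', Real.rpow_one] at hpow
  exact absurd hn (not_lt.mpr hpow)
end

section
/- Let m ≥ 2 be an integer. There do not exist a real number r ∈ [1, ∞) and a constant C > 0 such that (∑_{|α|=m} |a_α|^r)^{1/r} ≤ C‖P‖ holds for every positive integer n and every m-homogeneous polynomial P(x) = ∑_{|α|=m} a_α x^α on ℓ_m^n (𝕂 = ℝ or ℂ). -/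
open scoped BigOperators

/-- The power sum `∑ i, X i ^ m` has norm at most one on the unit ball of `ℓ_m^n`. -/
theorem polyNorm_psum_le_one (𝕂 : Type*) [RCLike 𝕂] {m : ℕ} (hm : m ≠ 0) (n : ℕ) :
    polyNorm 𝕂 (m : ℝ) (MvPolynomial.psum (Fin n) 𝕂 m) ≤ 1 := by
  refine Real.sSup_le ?_ zero_le_one
  rintro t ⟨x, hx, rfl⟩
  have hsum : ∑ i, ‖x i‖ ^ m ≤ 1 := by
    by_contra! h
    have hlt : 1 < (∑ i, ‖x i‖ ^ m) ^ (1 / (m : ℝ)) :=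
      Real.one_lt_rpow h (by positivity)
    simp only [lpNorm, Real.rpow_natCast] at hx
    exact absurd hx hlt.not_ge
  calc ‖MvPolynomial.eval x (MvPolynomial.psum (Fin n) 𝕂 m)‖ = ‖∑ i, x i ^ m‖ := by
        simp [MvPolynomial.psum]
    _ ≤ ∑ i, ‖x i ^ m‖ := norm_sum_le _ _
    _ ≤ 1 := by simpa only [norm_pow] using hsum

theorem coeff_single_psum {σ R : Type*} [Fintype σ] [CommSemiring R] {m : ℕ} (hm : m ≠ 0)
    (i : σ) : MvPolynomial.coeff (Finsupp.single i m) (MvPolynomial.psum σ R m) = 1 := by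
  classical
  simp [MvPolynomial.psum, MvPolynomial.coeff_sum, MvPolynomial.coeff_X_pow,
    Finsupp.single_left_inj hm]

theorem natCast_le_sum_norm_coeff_psum_rpow (𝕂 : Type*) [RCLike 𝕂] {m : ℕ} (hm : m ≠ 0)
    (n : ℕ) (r : ℝ) :
    (n : ℝ) ≤ ∑ α ∈ (MvPolynomial.psum (Fin n) 𝕂 m).support,
      ‖MvPolynomial.coeff α (MvPolynomial.psum (Fin n) 𝕂 m)‖ ^ r := by
  classical
  have hinj : Function.Injective fun i : Fin n => Finsupp.single i m :=
    Finsupp.single_left_injective hm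
  calc (n : ℝ) = ∑ α ∈ Finset.univ.image fun i : Fin n => Finsupp.single i m,
        ‖MvPolynomial.coeff α (MvPolynomial.psum (Fin n) 𝕂 m)‖ ^ r := by
        rw [Finset.sum_image hinj.injOn]
        simp [coeff_single_psum hm]
    _ ≤ _ := by
        refine Finset.sum_le_sum_of_subset_of_nonneg ?_ fun _ _ _ => by positivity
        intro α hα
        obtain ⟨i, -, rfl⟩ := Finset.mem_image.mp hα
        simp [MvPolynomial.mem_support_iff, coeff_single_psum hm]

theorem no_ell_r_HL_for_m_homogeneous_on_ell_m
    (𝕂 : Type*) [RCLike 𝕂] (m : ℕ) (hm : 2 ≤ m) :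
    ¬ ∃ r : ℝ, 1 ≤ r ∧ ∃ C : ℝ, 0 < C ∧
      ∀ n : ℕ, 0 < n → ∀ P : MvPolynomial (Fin n) 𝕂, P.IsHomogeneous m →
        (∑ α ∈ P.support, ‖MvPolynomial.coeff α P‖ ^ r) ^ (1 / r)
          ≤ C * polyNorm 𝕂 (m : ℝ) P := by
  rintro ⟨r, hr, C, hC, h⟩
  have hm0 : m ≠ 0 := by omega
  have hr0 : 0 < r := by linarith
  obtain ⟨n, hn⟩ := exists_nat_gt (C ^ r)
  have hn0 : 0 < n := by
    have : (0 : ℝ) < n := (Real.rpow_pos_of_pos hC r).trans hn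
    exact_mod_cast this
  have hle : (n : ℝ) ^ (1 / r) ≤ C := by
    calc (n : ℝ) ^ (1 / r)
        ≤ (∑ α ∈ (MvPolynomial.psum (Fin n) 𝕂 m).support,
            ‖MvPolynomial.coeff α (MvPolynomial.psum (Fin n) 𝕂 m)‖ ^ r) ^ (1 / r) :=
          Real.rpow_le_rpow n.cast_nonneg (natCast_le_sum_norm_coeff_psum_rpow 𝕂 hm0 n r)
            (by positivity)
      _ ≤ C * polyNorm 𝕂 (m : ℝ) (MvPolynomial.psum (Fin n) 𝕂 m) :=
          h n hn0 _ (MvPolynomial.IsHomogeneous.sum _ _ _ fun i _ =>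
            MvPolynomial.isHomogeneous_X_pow i m)
      _ ≤ C := mul_le_of_le_one_right hC.le (polyNorm_psum_le_one 𝕂 hm0 n)
  have hlt : C < (n : ℝ) ^ (1 / r) := by
    rw [one_div]
    exact (Real.lt_rpow_inv_iff_of_pos hC.le n.cast_nonneg hr0).mpr hn
  exact absurd hle hlt.not_ge
end

section
/- (Choi–Kim) A real 2-homogeneous polynomial P(x, y) = ax² + by² + cxy with ‖P‖ = 1 is an extreme point of the closed unit ball of the space of real 2-homogeneous polynomials on ℓ_2² (with the norm ‖·‖) if and only if either (i) |a| = |b| = 1 and c = 0, or (ii) a = −b, 0 < |c| ≤ 2 and 4a² = 4 − c². -/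
/-- The sup norm of the real 2-homogeneous polynomial `a x² + b y² + c xy`
on the euclidean unit ball of `ℝ²`. -/
noncomputable def P2norm (a b c : ℝ) : ℝ :=
  sSup {t : ℝ | ∃ x y : ℝ, x ^ 2 + y ^ 2 ≤ 1 ∧ t = |a * x ^ 2 + b * y ^ 2 + c * x * y|}

/-- The closed unit ball of the space of real 2-homogeneous polynomials on `ℓ_2²`,
identified with coefficient triples `(a, b, c)`. -/
noncomputable def P2unitBall : Set (ℝ × ℝ × ℝ) :=
  {q : ℝ × ℝ × ℝ | P2norm q.1 q.2.1 q.2.2 ≤ 1}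

/-- A symmetric quadratic form is bounded by its spectral radius times the squared norm. -/
theorem abs_quadratic_le (a b c x y : ℝ) :
    |a * x ^ 2 + b * y ^ 2 + c * x * y| ≤
      (|a + b| + √((a - b) ^ 2 + c ^ 2)) / 2 * (x ^ 2 + y ^ 2) := by
  have hn : 0 ≤ x ^ 2 + y ^ 2 := by positivity
  have hcs : |(a - b) * (x ^ 2 - y ^ 2) + c * (2 * x * y)| ≤
      √((a - b) ^ 2 + c ^ 2) * (x ^ 2 + y ^ 2) := by
    refine abs_le_of_sq_le_sq ?_ (by positivity)
    rw [mul_pow, Real.sq_sqrt (by positivity)]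
    nlinarith [sq_nonneg ((a - b) * (2 * x * y) - c * (x ^ 2 - y ^ 2))]
  have htr : |(a + b) * (x ^ 2 + y ^ 2)| = |a + b| * (x ^ 2 + y ^ 2) := by
    rw [abs_mul, abs_of_nonneg hn]
  have hadd := abs_add_le ((a + b) * (x ^ 2 + y ^ 2))
    ((a - b) * (x ^ 2 - y ^ 2) + c * (2 * x * y))
  have heq : (a + b) * (x ^ 2 + y ^ 2) + ((a - b) * (x ^ 2 - y ^ 2) + c * (2 * x * y)) =
      2 * (a * x ^ 2 + b * y ^ 2 + c * x * y) := by ring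
  rw [heq, abs_mul, abs_two] at hadd
  linarith

/-- On the unit circle a quadratic form takes the values of both its eigenvalues. -/
theorem exists_quadratic_eq (a b c : ℝ) :
    ∃ x y : ℝ, x ^ 2 + y ^ 2 = 1 ∧
      2 * (a * x ^ 2 + b * y ^ 2 + c * x * y) = a + b + √((a - b) ^ 2 + c ^ 2) ∧
      2 * (a * y ^ 2 + b * x ^ 2 - c * x * y) = a + b - √((a - b) ^ 2 + c ^ 2) := by
  set z : ℂ := ⟨a - b, c⟩ with hz
  have hnorm : ‖z‖ = √((a - b) ^ 2 + c ^ 2) := by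
    rw [Complex.norm_eq_sqrt_sq_add_sq]
  have hre : ‖z‖ * Real.cos z.arg = a - b := Complex.norm_mul_cos_arg z
  have him : ‖z‖ * Real.sin z.arg = c := Complex.norm_mul_sin_arg z
  obtain ⟨t, ht⟩ : ∃ t, z.arg = 2 * t := ⟨z.arg / 2, by ring⟩
  rw [ht, Real.cos_two_mul] at hre
  rw [ht, Real.sin_two_mul] at him
  have hcs := Real.cos_sq_add_sin_sq t
  rw [← hnorm]
  generalize ‖z‖ = r at *
  generalize Real.cos t = x at *
  generalize Real.sin t = y at *
  have hy : y ^ 2 = 1 - x ^ 2 := by linarith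
  have hxy : c * x * y = 2 * r * x ^ 2 * (1 - x ^ 2) := by
    rw [← him, ← hy]; ring
  refine ⟨x, y, hcs, ?_, ?_⟩
  · rw [hxy, hy]
    linear_combination (1 - 2 * x ^ 2) * hre
  · rw [hxy, hy]
    linear_combination (2 * x ^ 2 - 1) * hre

theorem P2norm_eq (a b c : ℝ) :
    P2norm a b c = (|a + b| + √((a - b) ^ 2 + c ^ 2)) / 2 := by
  refine IsGreatest.csSup_eq ⟨?_, ?_⟩
  · obtain ⟨x, y, hxy, hmax, hmin⟩ := exists_quadratic_eq a b c
    have hr := Real.sqrt_nonneg ((a - b) ^ 2 + c ^ 2)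
    rcases le_total 0 (a + b) with h | h
    · refine ⟨x, y, hxy.le, ?_⟩
      rw [abs_of_nonneg h, abs_of_nonneg (by linarith)]
      linarith
    · refine ⟨y, -x, by nlinarith, ?_⟩
      rw [abs_of_nonpos h, abs_of_nonpos (by nlinarith)]
      linarith
  · rintro t ⟨x, y, hxy, rfl⟩
    exact (abs_quadratic_le a b c x y).trans (mul_le_of_le_one_right (by positivity) hxy)

theorem mem_P2unitBall (a b c : ℝ) :
    (a, b, c) ∈ P2unitBall ↔ |a + b| + √((a - b) ^ 2 + c ^ 2) ≤ 2 := by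
  simp only [P2unitBall, Set.mem_ofPred_eq, P2norm_eq]
  constructor <;> intro h <;> linarith

/-- The unit ball is a double cone; points that lie neither at an apex nor on the equator are
inside a generating segment. -/
theorem apex_or_equator_of_mem_extremePoints {a b c : ℝ}
    (hnorm : |a + b| + √((a - b) ^ 2 + c ^ 2) = 2)
    (hext : (a, b, c) ∈ Set.extremePoints ℝ P2unitBall) :
    √((a - b) ^ 2 + c ^ 2) = 0 ∨ a + b = 0 := by
  by_contra! hne
  obtain ⟨hr0, hs0⟩ := hne
  have hsq : √((a - b) ^ 2 + c ^ 2) ^ 2 = (a - b) ^ 2 + c ^ 2 := Real.sq_sqrt (by positivity)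
  have hr : 0 < √((a - b) ^ 2 + c ^ 2) := lt_of_le_of_ne (Real.sqrt_nonneg _) hr0.symm
  have hs : 0 < |a + b| := abs_pos.mpr hs0
  generalize √((a - b) ^ 2 + c ^ 2) = r at *
  obtain ⟨e, he, hes⟩ : ∃ e : ℝ, |e| = 1 ∧ a + b = |a + b| * e := by
    rcases abs_choice (a + b) with h | h
    · exact ⟨1, by simp, by linarith⟩
    · exact ⟨-1, by simp, by linarith⟩
  have hapex : (e, e, (0 : ℝ)) ∈ P2unitBall := by
    rw [mem_P2unitBall, ← two_mul, abs_mul, he]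
    simp
  have hequator : ((a - b) / r, -((a - b) / r), 2 * c / r) ∈ P2unitBall := by
    have h4 : ((a - b) / r - -((a - b) / r)) ^ 2 + (2 * c / r) ^ 2 = 2 ^ 2 := by
      field_simp
      linarith
    rw [mem_P2unitBall, h4, Real.sqrt_sq (by norm_num), add_neg_cancel]
    simp
  have hseg : (a, b, c) ∈ openSegment ℝ (e, e, (0 : ℝ))
      ((a - b) / r, -((a - b) / r), 2 * c / r) := by
    refine ⟨|a + b| / 2, r / 2, by positivity, by positivity, by linarith, ?_⟩
    have hu : r / 2 * ((a - b) / r) = (a - b) / 2 := by field_simp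
    have hc : r / 2 * (2 * c / r) = c := by field_simp
    simp only [Prod.smul_mk, Prod.mk_add_mk, smul_eq_mul, Prod.mk.injEq, mul_neg, hu, hc]
    exact ⟨by linarith, by linarith, by ring⟩
  have heq := hext.2 hapex hequator hseg
  simp only [Prod.mk.injEq] at heq
  obtain ⟨ha, hb, hc⟩ := heq
  rw [← ha, ← hb, ← hc] at hsq
  have : r ^ 2 = 0 := by rw [hsq]; ring
  exact hr.ne' (pow_eq_zero_iff two_ne_zero |>.mp this)

theorem apex_mem_extremePoints {e : ℝ} (he : |e| = 1) :
    (e, e, (0 : ℝ)) ∈ Set.extremePoints ℝ P2unitBall := by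
  refine ⟨by rw [mem_P2unitBall, ← two_mul, abs_mul, he]; simp, ?_⟩
  rintro ⟨a₁, b₁, c₁⟩ h₁ ⟨a₂, b₂, c₂⟩ h₂ ⟨α, β, hα, hβ, hαβ, heq⟩
  rw [mem_P2unitBall] at h₁ h₂
  simp only [Prod.smul_mk, Prod.mk_add_mk, smul_eq_mul, Prod.mk.injEq] at heq ⊢
  obtain ⟨ha, hb, -⟩ := heq
  have hee : e * e = 1 := by rw [← abs_mul_abs_self, he, one_mul]
  have bound : ∀ s : ℝ, e * s ≤ |s| := fun s => by
    simpa [abs_mul, he] using le_abs_self (e * s)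
  have hr₁ := Real.sqrt_nonneg ((a₁ - b₁) ^ 2 + c₁ ^ 2)
  have hr₂ := Real.sqrt_nonneg ((a₂ - b₂) ^ 2 + c₂ ^ 2)
  have hs₁ := bound (a₁ + b₁)
  have hs₂ := bound (a₂ + b₂)
  have hsum : α * (e * (a₁ + b₁)) + β * (e * (a₂ + b₂)) = 2 := by
    linear_combination e * ha + e * hb + 2 * hee
  have htop : 2 ≤ e * (a₁ + b₁) := by
    by_contra! hlt
    nlinarith [mul_pos hα (sub_pos.mpr hlt),
      mul_nonneg hβ.le (show 0 ≤ 2 - e * (a₂ + b₂) by linarith)]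
  have hzero : (a₁ - b₁) ^ 2 + c₁ ^ 2 = 0 :=
    (Real.sqrt_eq_zero (by positivity)).mp (by linarith)
  have hc : c₁ = 0 := by nlinarith [sq_nonneg (a₁ - b₁)]
  have hab : a₁ - b₁ = 0 := by nlinarith [sq_nonneg c₁]
  have hsum₁ : e * (a₁ + b₁) = 2 := by linarith
  have hs : a₁ + b₁ = 2 * e := by linear_combination e * hsum₁ - (a₁ + b₁) * hee
  exact ⟨by linarith, by linarith, hc⟩

theorem equator_mem_extremePoints {a c : ℝ} (h : 4 * a ^ 2 + c ^ 2 = 4) :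
    (a, -a, c) ∈ Set.extremePoints ℝ P2unitBall := by
  have hsqrt : ∀ u v : ℝ, u ^ 2 + v ^ 2 = 4 → √(u ^ 2 + v ^ 2) = 2 := fun u v huv => by
    rw [huv, show (4 : ℝ) = 2 ^ 2 by norm_num, Real.sqrt_sq (by norm_num)]
  have hdisk : ∀ a b c : ℝ, |a + b| + √((a - b) ^ 2 + c ^ 2) ≤ 2 →
      (a - b) ^ 2 + c ^ 2 ≤ 4 := fun a b c hm => by
    have := (Real.sqrt_le_left (by norm_num : (0 : ℝ) ≤ 2)).mp
      (show √((a - b) ^ 2 + c ^ 2) ≤ 2 by linarith [abs_nonneg (a + b)])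
    linarith
  refine ⟨?_, ?_⟩
  · rw [mem_P2unitBall, hsqrt _ _ (by linear_combination h), add_neg_cancel]
    simp
  rintro ⟨a₁, b₁, c₁⟩ h₁ ⟨a₂, b₂, c₂⟩ h₂ ⟨α, β, hα, hβ, hαβ, heq⟩
  rw [mem_P2unitBall] at h₁ h₂
  simp only [Prod.smul_mk, Prod.mk_add_mk, smul_eq_mul, Prod.mk.injEq] at heq ⊢
  obtain ⟨ha, hb, hc⟩ := heq
  have hd₁ := hdisk _ _ _ h₁
  have hd₂ := hdisk _ _ _ h₂
  have hu : α * (a₁ - b₁) + β * (a₂ - b₂) = 2 * a := by linear_combination ha - hb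
  have hβ' : β = 1 - α := by linarith
  have hconv : α * β * (((a₁ - b₁) - (a₂ - b₂)) ^ 2 + (c₁ - c₂) ^ 2) =
      α * ((a₁ - b₁) ^ 2 + c₁ ^ 2) + β * ((a₂ - b₂) ^ 2 + c₂ ^ 2) - 4 := by
    have hsq : (α * (a₁ - b₁) + β * (a₂ - b₂)) ^ 2 + (α * c₁ + β * c₂) ^ 2 = 4 := by
      rw [hu, hc]; linear_combination h
    rw [← hsq, hβ']
    ring
  have hle : ((a₁ - b₁) - (a₂ - b₂)) ^ 2 + (c₁ - c₂) ^ 2 ≤ 0 := by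
    refine nonpos_of_mul_nonpos_right ?_ (mul_pos hα hβ)
    rw [hconv]
    nlinarith [mul_le_mul_of_nonneg_left hd₁ hα.le, mul_le_mul_of_nonneg_left hd₂ hβ.le]
  have hueq : (a₁ - b₁) - (a₂ - b₂) = 0 := by nlinarith [sq_nonneg (c₁ - c₂)]
  have hceq : c₁ - c₂ = 0 := by nlinarith [sq_nonneg ((a₁ - b₁) - (a₂ - b₂))]
  have hu₁ : a₁ - b₁ = 2 * a := by
    linear_combination hu + β * hueq - (a₁ - b₁) * hαβ
  have hc₁ : c₁ = c := by linear_combination hc + β * hceq - c₁ * hαβ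
  rw [hsqrt _ _ (by rw [hu₁, hc₁]; linear_combination h)] at h₁
  have hs₁ : a₁ + b₁ = 0 := abs_nonpos_iff.mp (by linarith)
  exact ⟨by linarith, by linarith, hc₁⟩

theorem choi_kim_extreme_points (a b c : ℝ) (hP : P2norm a b c = 1) :
    (a, b, c) ∈ Set.extremePoints ℝ P2unitBall ↔
      ((|a| = 1 ∧ |b| = 1 ∧ c = 0) ∨
        (a = -b ∧ 0 < |c| ∧ |c| ≤ 2 ∧ 4 * a ^ 2 = 4 - c ^ 2)) := by
  constructor
  · intro hext
    rw [P2norm_eq] at hP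
    have hnorm : |a + b| + √((a - b) ^ 2 + c ^ 2) = 2 := by linarith
    rcases apex_or_equator_of_mem_extremePoints hnorm hext with hr | hs
    · have hzero := (Real.sqrt_eq_zero (by positivity)).mp hr
      have hc : c = 0 := by nlinarith [sq_nonneg (a - b)]
      have hab : a - b = 0 := by nlinarith [sq_nonneg c]
      obtain rfl : a = b := by linarith
      rw [hr, ← two_mul, abs_mul, abs_two] at hnorm
      exact Or.inl ⟨by linarith, by linarith, hc⟩
    · obtain rfl : a = -b := by linarith
      have hsq := Real.sq_sqrt (show 0 ≤ (-b - b) ^ 2 + c ^ 2 by positivity)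
      rw [hs, abs_zero, zero_add] at hnorm
      rw [hnorm] at hsq
      by_cases hc : c = 0
      · subst hc
        have hb : |b| = 1 := by
          rw [← abs_one, ← sq_eq_sq_iff_abs_eq_abs]
          linarith
        exact Or.inl ⟨by rwa [abs_neg], hb, rfl⟩
      · exact Or.inr ⟨rfl, abs_pos.mpr hc,
          abs_le_of_sq_le_sq (by nlinarith [sq_nonneg b]) (by norm_num), by linarith⟩
  · rintro (⟨ha, hb, rfl⟩ | ⟨hab, -, -, h⟩)
    · rcases abs_eq_abs.mp (ha.trans hb.symm) with rfl | rfl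
      · exact apex_mem_extremePoints ha
      · have hsq : b ^ 2 = 1 := by rw [← sq_abs, hb, one_pow]
        simpa using equator_mem_extremePoints (a := -b) (c := 0) (by linarith)
    · obtain rfl : b = -a := by linarith
      exact equator_mem_extremePoints (by linarith)
end

section
/- If C > 0 is a constant such that max{|a|, |b|, |c|} ≤ C · sup{|P(x, y)| : x² + y² ≤ 1} holds for every real 2-homogeneous polynomial P(x, y) = ax² + by² + cxy, then C ≥ 2; consequently 2 is the optimal constant in the Hardy–Littlewood inequality for 2-homogeneous polynomials on real ℓ_2². -/
theorem abs_eval_le_P2norm (a b c : ℝ) {x y : ℝ} (h : x ^ 2 + y ^ 2 ≤ 1) :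
    |a * x ^ 2 + b * y ^ 2 + c * x * y| ≤ P2norm a b c := by
  refine le_csSup ⟨|a| + |b| + |c|, ?_⟩ ⟨x, y, h, rfl⟩
  rintro t ⟨u, v, huv, rfl⟩
  have hu : |u ^ 2| ≤ 1 := by
    rw [abs_of_nonneg (sq_nonneg u)]
    linarith [sq_nonneg v]
  have hv : |v ^ 2| ≤ 1 := by
    rw [abs_of_nonneg (sq_nonneg v)]
    linarith [sq_nonneg u]
  have huv' : |u * v| ≤ 1 := by
    rw [abs_le]
    constructor <;> nlinarith [sq_nonneg (u + v), sq_nonneg (u - v)]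
  calc |a * u ^ 2 + b * v ^ 2 + c * u * v|
      ≤ |a * u ^ 2| + |b * v ^ 2| + |c * u * v| := abs_add_three _ _ _
    _ = |a| * |u ^ 2| + |b| * |v ^ 2| + |c| * |u * v| := by
      rw [mul_assoc c, abs_mul, abs_mul, abs_mul c]
    _ ≤ |a| + |b| + |c| := by
      gcongr
      · exact mul_le_of_le_one_right (abs_nonneg a) hu
      · exact mul_le_of_le_one_right (abs_nonneg b) hv
      · exact mul_le_of_le_one_right (abs_nonneg c) huv'

theorem P2norm_mul_le : P2norm 0 0 1 ≤ 1 / 2 := by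
  refine csSup_le ⟨_, 0, 0, by norm_num, rfl⟩ ?_
  rintro t ⟨x, y, h, rfl⟩
  rw [abs_le]
  constructor <;> nlinarith [sq_nonneg (x + y), sq_nonneg (x - y)]

theorem abs_mixed_coeff_le (a b c : ℝ) : |c| ≤ 2 * P2norm a b c := by
  obtain ⟨s, hs⟩ : ∃ s : ℝ, s ^ 2 = 1 / 2 := ⟨√(1 / 2), Real.sq_sqrt (by norm_num)⟩
  have h₁ := abs_eval_le_P2norm a b c (x := s) (y := s) (by linarith)
  have h₂ := abs_eval_le_P2norm a b c (x := s) (y := -s) (by rw [neg_sq]; linarith)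
  have hc : c = (a * s ^ 2 + b * s ^ 2 + c * s * s) -
      (a * s ^ 2 + b * (-s) ^ 2 + c * s * (-s)) := by
    linear_combination (-2 * c) * hs
  rw [abs_le] at *
  constructor <;> linarith

/-- `2` is the optimal (i.e. least) constant in the Hardy–Littlewood inequality for
real 2-homogeneous polynomials on `ℓ_2²`: every admissible constant `C > 0` satisfies
`C ≥ 2`, and `2` itself is admissible. -/
theorem optimal_constant_two_homogeneous_ell_two_two :
    IsLeast {C : ℝ | 0 < C ∧
      ∀ a b c : ℝ, max (max |a| |b|) |c| ≤ C * P2norm a b c} 2 := by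
  refine ⟨⟨by norm_num, fun a b c => ?_⟩, ?_⟩
  · have ha := abs_eval_le_P2norm a b c (x := 1) (y := 0) (by norm_num)
    have hb := abs_eval_le_P2norm a b c (x := 0) (y := 1) (by norm_num)
    norm_num at ha hb
    have h₀ := (abs_nonneg a).trans ha
    exact max_le (max_le (by linarith) (by linarith)) (abs_mixed_coeff_le a b c)
  · rintro C ⟨hC, h⟩
    have h₁ := h 0 0 1
    norm_num at h₁
    nlinarith [P2norm_mul_le]
end
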